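/- Let N ≥ 3. Then for every integer k ≥ 0 and every p with 1 ≤ p ≤ ∞, the Lyapunov constant γ_{p,k} is strictly positive if and only if N/2 ≤ p ≤ ∞ (in particular γ_{p,k} = 0 whenever 1 ≤ p < N/2). -/

import Mathlib

open MeasureTheory Set Filter

noncomputable section

/-- The measure of the (N-1)-dimensional unit sphere in `ℝ^N`. -/
def omegaN (N : ℕ) : ℝ :=
  N * (volume (Metric.ball (0 : EuclideanSpace ℝ (Fin N)) 1)).toReal

/-- `u` is a radial Neumann solution of `Δu + a u = 0` on the unit ball of `ℝ^N`,
with explicit derivative function `u'` : `u` is continuous on `[0,1]`, differentiable on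
`(0,1]`, satisfies the integrated radial equation
`r^(N-1) u'(r) = -∫_0^r s^(N-1) a(s) u(s) ds` on `(0,1]`, and `u'(1) = 0`. -/
def IsRadialNeumannSolutionDeriv (N : ℕ) (a u u' : ℝ → ℝ) : Prop :=
  ContinuousOn u (Icc 0 1) ∧
  (∀ r ∈ Ioc (0:ℝ) 1, HasDerivAt u (u' r) r) ∧
  (∀ r ∈ Ioc (0:ℝ) 1,
    r ^ (N - 1) * u' r = - ∫ s in (0:ℝ)..r, s ^ (N - 1) * a s * u s) ∧
  u' 1 = 0

/-- `u` is a radial Neumann solution of `Δu + a u = 0` on the unit ball of `ℝ^N`. -/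
def IsRadialNeumannSolution (N : ℕ) (a u : ℝ → ℝ) : Prop :=
  ∃ u' : ℝ → ℝ, IsRadialNeumannSolutionDeriv N a u u'

/-- `u` is not identically zero on `[0,1]`. -/
def NontrivialSol (u : ℝ → ℝ) : Prop := ∃ r ∈ Icc (0:ℝ) 1, u r ≠ 0

/-- `μ ≺ a` : `a(r) ≥ μ` for a.e. `r ∈ (0,1)` and `a(r) > μ` on a set of positive measure. -/
def Prec (μ : ℝ) (a : ℝ → ℝ) : Prop :=
  (∀ᵐ r ∂(volume.restrict (Ioo (0:ℝ) 1)), μ ≤ a r) ∧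
  0 < volume {r ∈ Ioo (0:ℝ) 1 | μ < a r}

/-- A radial function `a` belongs to `L^p(B_1)` (finite `p`). -/
def RadialMemLp (N : ℕ) (p : ℝ) (a : ℝ → ℝ) : Prop :=
  IntegrableOn (fun r => r ^ (N - 1) * |a r| ^ p) (Ioo (0:ℝ) 1)

/-- A radial function `a` belongs to `L^∞(B_1)`. -/
def RadialMemLinfty (a : ℝ → ℝ) : Prop :=
  ∃ C : ℝ, ∀ᵐ r ∂(volume.restrict (Ioo (0:ℝ) 1)), |a r| ≤ C

/-- The `L^p(B_1)` norm of a radial function (finite `p`):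
`(ω_N ∫_0^1 r^(N-1) |a(r)|^p dr)^(1/p)`. -/
def radialLpNorm (N : ℕ) (p : ℝ) (a : ℝ → ℝ) : ℝ :=
  (omegaN N * ∫ r in (0:ℝ)..1, r ^ (N - 1) * |a r| ^ p) ^ (1 / p)

/-- The `L^∞(B_1)` norm of a radial function: essential supremum of `|a|` on `(0,1)`. -/
def radialLinftyNorm (a : ℝ → ℝ) : ℝ :=
  essSup (fun r => |a r|) (volume.restrict (Ioo (0:ℝ) 1))

/-- The admissible class `Γ_k` at level `μk`: radial measurable `a` with `μk ≺ a`, such that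
`Δu + a u = 0` has a nontrivial radial Neumann solution, and `a ∈ L^{N/2}(B_1)` if `N ≥ 3`,
or `a ∈ L^q(B_1)` for some `q ∈ (1,∞]` if `N = 2`. -/
def GammaSet (N : ℕ) (μk : ℝ) (a : ℝ → ℝ) : Prop :=
  Measurable a ∧ Prec μk a ∧
  (∃ u : ℝ → ℝ, IsRadialNeumannSolution N a u ∧ NontrivialSol u) ∧
  (if 3 ≤ N then RadialMemLp N ((N : ℝ) / 2) a
   else (∃ q : ℝ, 1 < q ∧ RadialMemLp N q a) ∨ RadialMemLinfty a)

/-- The Lyapunov constant `γ_{p,k}` for finite `p`. -/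
def gammaLyap (N : ℕ) (μk : ℝ) (p : ℝ) : ℝ :=
  sInf {t : ℝ | ∃ a : ℝ → ℝ, GammaSet N μk a ∧ RadialMemLp N p a ∧
    t = radialLpNorm N p (fun r => a r - μk)}

/-- The Lyapunov constant `γ_{∞,k}`. -/
def gammaLyapInfty (N : ℕ) (μk : ℝ) : ℝ :=
  sInf {t : ℝ | ∃ a : ℝ → ℝ, GammaSet N μk a ∧ RadialMemLinfty a ∧
    t = radialLinftyNorm (fun r => a r - μk)}

/-- `(μ, φ)` is the `k`-th radial Neumann eigenpair of `-Δ` on `B_1 ⊆ ℝ^N`: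
`μ ≥ 0`, `φ` is a nontrivial radial Neumann solution of `Δφ + μ φ = 0` having exactly `k`
zeros in `(0,1)`, all simple, given by `rz k < rz (k-1) < ⋯ < rz 1`. -/
def IsRadialNeumannEigenpair (N k : ℕ) (μ : ℝ) (φ : ℝ → ℝ) (rz : ℕ → ℝ) : Prop :=
  0 ≤ μ ∧
  IsRadialNeumannSolution N (fun _ => μ) φ ∧ NontrivialSol φ ∧
  (∀ i, 1 ≤ i → i ≤ k → rz i ∈ Ioo (0:ℝ) 1) ∧
  (∀ i j, 1 ≤ i → i < j → j ≤ k → rz j < rz i) ∧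
  (∀ x ∈ Ioo (0:ℝ) 1, (φ x = 0 ↔ ∃ i, 1 ≤ i ∧ i ≤ k ∧ x = rz i)) ∧
  (∀ i, 1 ≤ i → i ≤ k → ∃ d : ℝ, d ≠ 0 ∧ HasDerivAt φ d (rz i))

/-- `u` (with derivative `u'`) is a radial `H^1` solution of `Δu + a u = 0` in `B_1`:
continuous on `(0,1]`, differentiable on `(0,1)`, satisfying the integrated radial equation
between any two radii, with finite radial `H^1` energy. -/
def IsRadialH1Solution (N : ℕ) (a u u' : ℝ → ℝ) : Prop :=
  ContinuousOn u (Ioc 0 1) ∧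
  (∀ r ∈ Ioo (0:ℝ) 1, HasDerivAt u (u' r) r) ∧
  (∀ s ∈ Ioo (0:ℝ) 1, ∀ r ∈ Ioo (0:ℝ) 1, s < r →
    r ^ (N - 1) * u' r - s ^ (N - 1) * u' s
      = - ∫ t in s..r, t ^ (N - 1) * a t * u t) ∧
  IntegrableOn (fun r => r ^ (N - 1) * ((u' r) ^ 2 + (u r) ^ 2)) (Ioo (0:ℝ) 1)

/-- The Sobolev quotient: infimum of `(∫_{B_ρ} |∇w|²) / (∫_{B_ρ} |w|^q)^{2/q}` over nontrivial
`C^1` functions `w : ℝ^N → ℝ` with compact support contained in the ball `B_ρ`. -/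
def sobolevQuot (N : ℕ) (q : ℝ) (ρ : ℝ) : ℝ :=
  sInf {t : ℝ | ∃ w : EuclideanSpace ℝ (Fin N) → ℝ,
    ContDiff ℝ 1 w ∧ (∃ x, w x ≠ 0) ∧ tsupport w ⊆ Metric.ball 0 ρ ∧
    t = (∫ x in Metric.ball (0 : EuclideanSpace ℝ (Fin N)) ρ, ‖fderiv ℝ w x‖ ^ 2) /
        (∫ x in Metric.ball (0 : EuclideanSpace ℝ (Fin N)) ρ, |w x| ^ q) ^ (2 / q)}

/-- Product rule for two functions that are primitives of integrable functions. -/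
theorem integral_mul_add_mul_of_primitive {f g f' g' : ℝ → ℝ} {r s : ℝ} (hrs : r ≤ s)
    (hf' : IntervalIntegrable f' volume r s) (hg' : IntervalIntegrable g' volume r s)
    (hf : ∀ x ∈ Icc r s, f x = f r + ∫ t in r..x, f' t)
    (hg : ∀ x ∈ Icc r s, g x = g r + ∫ t in r..x, g' t) :
    f s * g s - f r * g r = ∫ t in r..s, (f' t * g t + f t * g' t) := by
  have hF : ∀ {h h' : ℝ → ℝ}, IntervalIntegrable h' volume r s →
      AbsolutelyContinuousOnInterval (fun x => h r + ∫ t in r..x, h' t) r s := by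
    intro h h' hh
    have h1 := hh.absolutelyContinuousOnInterval_intervalIntegral (c := r) (by simp)
    have h2 : AbsolutelyContinuousOnInterval (fun _ : ℝ => h r) r s :=
      (LipschitzWith.const (h r)).lipschitzOnWith.absolutelyContinuousOnInterval
    exact h2.add h1
  have key := AbsolutelyContinuousOnInterval.integral_deriv_mul_eq_sub
    (hF (h := f) hf') (hF (h := g) hg')
  simp only [intervalIntegral.integral_same, add_zero] at key
  rw [← hf s ⟨hrs, le_rfl⟩, ← hg s ⟨hrs, le_rfl⟩] at key
  rw [← key]
  apply intervalIntegral.integral_congr_ae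
  filter_upwards [hf'.ae_hasDerivAt_integral, hg'.ae_hasDerivAt_integral] with x h1 h2 hx
  have hx' : x ∈ uIcc r s := uIoc_subset_uIcc hx
  have e1 := ((h1 hx' r (by simp)).const_add (f r)).deriv
  have e2 := ((h2 hx' r (by simp)).const_add (g r)).deriv
  rw [uIcc_of_le hrs] at hx'
  rw [e1, e2, ← hf x hx', ← hg x hx']

/-- An integral inequality of Gronwall type, with the integral taken up to the right endpoint. -/
theorem gronwall_integral_right {f : ℝ → ℝ} {c d A K : ℝ} (hcd : c ≤ d)
    (hf : ContinuousOn f (Icc c d)) (hf0 : ∀ x ∈ Icc c d, 0 ≤ f x) (hA : 0 ≤ A) (hK : 0 < K)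
    (h : ∀ x ∈ Icc c d, f x ≤ A + K * ∫ t in x..d, f t) :
    ∀ x ∈ Icc c d, f x ≤ 2 * A * Real.exp (2 * K * (d - c)) := by
  obtain ⟨y, hy, hmax⟩ := isCompact_Icc.exists_isMaxOn (nonempty_Icc.2 hcd)
    (f := fun x => Real.exp (-(2 * K) * (d - x)) * f x) (by fun_prop)
  set m := Real.exp (-(2 * K) * (d - y)) * f y with hm
  have hm0 : 0 ≤ m := mul_nonneg (Real.exp_pos _).le (hf0 y hy)
  have hle : ∀ x ∈ Icc c d, f x ≤ m * Real.exp (2 * K * (d - x)) := by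
    intro x hx
    have h1 : Real.exp (-(2 * K) * (d - x)) * f x ≤ m := hmax hx
    have h2 : Real.exp (-(2 * K) * (d - x)) * Real.exp (2 * K * (d - x)) = 1 := by
      rw [← Real.exp_add]; simp
    calc f x = (Real.exp (-(2 * K) * (d - x)) * f x) * Real.exp (2 * K * (d - x)) := by
          linear_combination -f x * h2
      _ ≤ _ := by gcongr
  have hfi : ∫ t in y..d, f t ≤ m * ((Real.exp (2 * K * (d - y)) - 1) / (2 * K)) := by
    have h1 : ∫ t in y..d, m * Real.exp (2 * K * (d - t))
        = m * ((Real.exp (2 * K * (d - y)) - 1) / (2 * K)) := by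
      have hd : ∀ x ∈ uIcc y d, HasDerivAt (fun t => -(m * (Real.exp (2 * K * (d - t)) / (2 * K))))
          (m * Real.exp (2 * K * (d - x))) x := by
        intro x _
        have e : HasDerivAt (fun t => 2 * K * (d - t)) (2 * K * (-1)) x :=
          ((hasDerivAt_id x).const_sub d).const_mul (2 * K)
        have e2 := (((e.exp).div_const (2 * K)).const_mul m).neg
        have e3 : -(m * (Real.exp (2 * K * (d - x)) * (2 * K * (-1)) / (2 * K)))
            = m * Real.exp (2 * K * (d - x)) := by field_simp
        rw [e3] at e2
        exact e2
      rw [intervalIntegral.integral_eq_sub_of_hasDerivAt hd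
        (Continuous.intervalIntegrable (by fun_prop) _ _)]
      simp; ring
    rw [← h1]
    apply intervalIntegral.integral_mono_on hy.2
    · apply ContinuousOn.intervalIntegrable_of_Icc hy.2
      exact hf.mono (Icc_subset_Icc_left hy.1)
    · exact Continuous.intervalIntegrable (by fun_prop) _ _
    · intro x hx
      exact hle x ⟨hy.1.trans hx.1, hx.2⟩
  have hm2 : m ≤ 2 * A := by
    have h1 := h y hy
    have h2 : f y = m * Real.exp (2 * K * (d - y)) := by
      rw [hm, mul_right_comm, ← Real.exp_add]; simp
    have h3 : f y ≤ A + m * (Real.exp (2 * K * (d - y)) - 1) / 2 := by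
      refine h1.trans ?_
      have := mul_le_mul_of_nonneg_left hfi hK.le
      have e : K * (m * ((Real.exp (2 * K * (d - y)) - 1) / (2 * K)))
        = m * (Real.exp (2 * K * (d - y)) - 1) / 2 := by field_simp
      linarith
    have h4 : 1 ≤ Real.exp (2 * K * (d - y)) := by
      apply Real.one_le_exp
      have := hy.2
      have : 0 ≤ d - y := by linarith
      positivity
    nlinarith
  intro x hx
  calc f x ≤ m * Real.exp (2 * K * (d - x)) := hle x hx
    _ ≤ 2 * A * Real.exp (2 * K * (d - c)) := by
      gcongr
      exact hx.1

/-- An integral inequality of Gronwall type forcing a function to vanish. -/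
theorem gronwall_integral_left_zero {f : ℝ → ℝ} {c d K : ℝ} (hcd : c ≤ d)
    (hf : ContinuousOn f (Icc c d)) (hf0 : ∀ x ∈ Icc c d, 0 ≤ f x) (hK : 0 < K)
    (h : ∀ x ∈ Icc c d, f x ≤ K * ∫ t in c..x, f t) :
    ∀ x ∈ Icc c d, f x = 0 := by
  have hmaps : ∀ x ∈ Icc c d, c + d - x ∈ Icc c d := fun x hx =>
    ⟨by linarith [hx.2], by linarith [hx.1]⟩
  have key := gronwall_integral_right (f := fun x => f (c + d - x)) (A := 0) hcd
    (hf.comp (by fun_prop) hmaps) (fun x hx => hf0 _ (hmaps x hx)) le_rfl hK (by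
      intro x hx
      have := h _ (hmaps x hx)
      rw [intervalIntegral.integral_comp_sub_left (fun t => f t) (c + d)]
      simpa using this)
  intro x hx
  have h1 := key _ (hmaps x hx)
  have h2 := hf0 x hx
  simp only [sub_sub_cancel, mul_zero, zero_mul] at h1
  exact le_antisymm h1 h2

/-- A radial Neumann solution `u` of `Δu + a u = 0` together with its flux
`U r = r ^ (N - 1) * u' r`, for a potential that is integrable on the ball. -/
structure RadialFluxSolution (N : ℕ) (a u U : ℝ → ℝ) : Prop where
  cont : ContinuousOn u (Icc 0 1)
  deriv : ∀ r ∈ Ioc (0:ℝ) 1, HasDerivAt u (U r / r ^ (N - 1)) r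
  int : IntervalIntegrable (fun s => s ^ (N - 1) * a s) volume 0 1
  flux : ∀ r ∈ Icc (0:ℝ) 1, U r = - ∫ s in (0:ℝ)..r, s ^ (N - 1) * a s * u s
  neumann : U 1 = 0

namespace RadialFluxSolution

variable {N : ℕ} {a u U : ℝ → ℝ}

theorem smul (h : RadialFluxSolution N a u U) (c : ℝ) :
    RadialFluxSolution N a (fun r => c * u r) (fun r => c * U r) where
  cont := h.cont.const_mul c
  deriv r hr := by
    have := (h.deriv r hr).const_mul c
    rwa [← mul_div_assoc] at this
  int := h.int
  flux r hr := by
    have e : ∀ s, s ^ (N - 1) * a s * (c * u s) = c * (s ^ (N - 1) * a s * u s) := fun s => by ring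
    simp only [e, intervalIntegral.integral_const_mul]
    rw [h.flux r hr]; ring
  neumann := by rw [h.neumann, mul_zero]

theorem int_mul (h : RadialFluxSolution N a u U) :
    IntervalIntegrable (fun s => s ^ (N - 1) * a s * u s) volume 0 1 :=
  h.int.mul_continuousOn (by rw [uIcc_of_le zero_le_one]; exact h.cont)

theorem int_mul_sub (h : RadialFluxSolution N a u U) {r s : ℝ} (hr : r ∈ Icc (0:ℝ) 1)
    (hs : s ∈ Icc (0:ℝ) 1) :
    IntervalIntegrable (fun s => s ^ (N - 1) * a s * u s) volume r s :=
  h.int_mul.mono_set (by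
    rw [uIcc_of_le zero_le_one]
    exact uIcc_subset_Icc hr hs)

theorem flux_zero (h : RadialFluxSolution N a u U) : U 0 = 0 := by
  rw [h.flux 0 ⟨le_rfl, zero_le_one⟩]; simp

theorem flux_sub (h : RadialFluxSolution N a u U) {r s : ℝ} (hr : r ∈ Icc (0:ℝ) 1)
    (hs : s ∈ Icc (0:ℝ) 1) : U s - U r = - ∫ t in r..s, t ^ (N - 1) * a t * u t := by
  have h0 : (0:ℝ) ∈ Icc (0:ℝ) 1 := ⟨le_rfl, zero_le_one⟩
  rw [h.flux s hs, h.flux r hr, ← intervalIntegral.integral_add_adjacent_intervals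
    (h.int_mul_sub h0 hr) (h.int_mul_sub hr hs)]
  ring

theorem flux_cont (h : RadialFluxSolution N a u U) : ContinuousOn U (Icc 0 1) := by
  have h1 := intervalIntegral.continuousOn_primitive_interval
    (f := fun t => t ^ (N - 1) * a t * u t) (μ := volume) (a := 0) (b := 1)
    (by
      have := h.int_mul
      rwa [intervalIntegrable_iff_integrableOn_Icc_of_le zero_le_one, ← uIcc_of_le zero_le_one]
        at this)
  rw [uIcc_of_le zero_le_one] at h1
  exact h1.neg.congr (fun r hr => h.flux r hr)

theorem deriv_cont (h : RadialFluxSolution N a u U) {c : ℝ} (hc : 0 < c) :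
    ContinuousOn (fun r => U r / r ^ (N - 1)) (Icc c 1) := by
  apply ContinuousOn.div
  · exact h.flux_cont.mono (Icc_subset_Icc_left hc.le)
  · fun_prop
  · intro x hx
    have : 0 < x := hc.trans_le hx.1
    positivity

theorem sub_eq (h : RadialFluxSolution N a u U) {r s : ℝ} (hr : 0 < r) (hrs : r ≤ s)
    (hs : s ≤ 1) : u s - u r = ∫ t in r..s, U t / t ^ (N - 1) := by
  symm
  apply intervalIntegral.integral_eq_sub_of_hasDerivAt
  · intro x hx
    rw [uIcc_of_le hrs] at hx
    exact h.deriv x ⟨hr.trans_le hx.1, hx.2.trans hs⟩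
  · apply ContinuousOn.intervalIntegrable_of_Icc hrs
    exact (h.deriv_cont hr).mono (Icc_subset_Icc_right hs)

/-- If the potential is small in a scale-invariant sense on a ball of radius `z`, a solution
vanishing at `z` vanishes on the whole ball. -/
theorem eq_zero_of_small (hN : 3 ≤ N) (h : RadialFluxSolution N a u U) {z : ℝ}
    (hz : z ∈ Ioc (0:ℝ) 1)
    (hfi : IntervalIntegrable (fun t => t ^ (N - 1) * |a t| / √t) volume 0 z)
    (hsmall : ∀ s ∈ Ioc (0:ℝ) z,
      ∫ t in (0:ℝ)..s, t ^ (N - 1) * |a t| / √t ≤ 3 / 8 * (s ^ (N - 2) / √s))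
    (huz : u z = 0) : ∀ r ∈ Ioc (0:ℝ) z, u r = 0 := by
  have hcont : ContinuousOn u (Icc 0 z) := h.cont.mono (Icc_subset_Icc_right hz.2)
  obtain ⟨y, hy, hmax⟩ := isCompact_Icc.exists_isMaxOn (nonempty_Icc.2 hz.1.le)
    (f := fun x => √x * |u x|) (by fun_prop)
  set M := √y * |u y| with hM
  have hM0 : 0 ≤ M := by positivity
  have hle : ∀ x ∈ Ioc (0:ℝ) z, |u x| ≤ M / √x := by
    intro x hx
    rw [le_div_iff₀ (Real.sqrt_pos.2 hx.1), mul_comm]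
    exact hmax ⟨hx.1.le, hx.2⟩
  have hU : ∀ s ∈ Ioc (0:ℝ) z, |U s| ≤ M * (3 / 8 * (s ^ (N - 2) / √s)) := by
    intro s hs
    rw [h.flux s ⟨hs.1.le, hs.2.trans hz.2⟩, abs_neg]
    have step : ‖∫ t in (0:ℝ)..s, t ^ (N - 1) * a t * u t‖
        ≤ ∫ t in (0:ℝ)..s, M * (t ^ (N - 1) * |a t| / √t) := by
      apply intervalIntegral.norm_integral_le_of_norm_le hs.1.le
      · refine Eventually.of_forall fun t ht => ?_
        have ht0 : 0 < t := ht.1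
        rw [Real.norm_eq_abs, abs_mul, abs_mul, abs_of_pos (pow_pos ht0 _)]
        calc t ^ (N - 1) * |a t| * |u t| ≤ t ^ (N - 1) * |a t| * (M / √t) := by
              gcongr; exact hle t ⟨ht.1, ht.2.trans hs.2⟩
          _ = _ := by ring
      · apply IntervalIntegrable.const_mul
        exact hfi.mono_set (by
          rw [uIcc_of_le hs.1.le, uIcc_of_le hz.1.le]
          exact Icc_subset_Icc_right hs.2)
    rw [intervalIntegral.integral_const_mul] at step
    exact step.trans (mul_le_mul_of_nonneg_left (hsmall s hs) hM0)
  have hder : ∀ s ∈ Ioc (0:ℝ) z, |U s / s ^ (N - 1)| ≤ 3 / 8 * M * (1 / (s * √s)) := by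
    intro s hs
    have hs0 : 0 < s := hs.1
    have e : s ^ (N - 1) = s ^ (N - 2) * s := by
      rw [← pow_succ]; congr 1; omega
    rw [abs_div, abs_of_pos (pow_pos hs0 _), div_le_iff₀ (pow_pos hs0 _)]
    refine (hU s hs).trans (le_of_eq ?_)
    have := Real.sqrt_pos.2 hs0
    rw [e]; field_simp
  have hinv : ∀ s : ℝ, 0 < s → HasDerivAt (fun x => 2 / √x) (-(1 / (s * √s))) s := by
    intro s hs
    have h1 := (Real.hasDerivAt_sqrt hs.ne').inv (Real.sqrt_pos.2 hs).ne' |>.const_mul 2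
    have h2 : 2 * (-(1 / (2 * √s)) / √s ^ 2) = -(1 / (s * √s)) := by
      rw [Real.sq_sqrt hs.le]
      have := Real.sqrt_pos.2 hs
      field_simp
    rw [h2] at h1
    simpa [div_eq_mul_inv] using h1
  have hone : ∀ v V : ℝ → ℝ, RadialFluxSolution N a v V → v z = 0 →
      (∀ s ∈ Ioc (0:ℝ) z, |V s / s ^ (N - 1)| ≤ 3 / 8 * M * (1 / (s * √s))) →
      ∀ r ∈ Ioc (0:ℝ) z, -(3 / 8 * M * (2 / √r)) ≤ v r := by
    intro v V hv hvz hV r hr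
    have hanti : AntitoneOn (fun x => v x + 3 / 8 * M * (2 / √x)) (Icc r z) := by
      have hd : ∀ x ∈ Icc r z, HasDerivAt (fun x => v x + 3 / 8 * M * (2 / √x))
          (V x / x ^ (N - 1) + 3 / 8 * M * (-(1 / (x * √x)))) x := fun x hx =>
        (hv.deriv x ⟨hr.1.trans_le hx.1, hx.2.trans hz.2⟩).add
          ((hinv x (hr.1.trans_le hx.1)).const_mul _)
      apply antitoneOn_of_deriv_nonpos (convex_Icc r z)
      · exact fun x hx => (hd x hx).continuousAt.continuousWithinAt
      · exact fun x hx => (hd x (interior_subset hx)).differentiableAt.differentiableWithinAt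
      · intro x hx
        have hx' := interior_subset hx
        rw [(hd x hx').deriv]
        have := (abs_le.1 (hV x ⟨hr.1.trans_le hx'.1, hx'.2⟩)).2
        linarith
    have h1 := hanti (left_mem_Icc.2 hr.2) (right_mem_Icc.2 hr.2) hr.2
    simp only [hvz] at h1
    have h2 : 0 ≤ 3 / 8 * M * (2 / √z) := by positivity
    linarith
  have hfin : ∀ r ∈ Ioc (0:ℝ) z, √r * |u r| ≤ 3 / 4 * M := by
    intro r hr
    have h1 := hone u U h huz hder r hr
    have h2 := hone _ _ (h.smul (-1)) (by simp [huz]) (by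
      intro s hs
      have := hder s hs
      rwa [neg_one_mul, neg_div, abs_neg]) r hr
    have h3 : |u r| ≤ 3 / 8 * M * (2 / √r) := abs_le.2 ⟨h1, by linarith⟩
    have h4 := Real.sqrt_pos.2 hr.1
    calc √r * |u r| ≤ √r * (3 / 8 * M * (2 / √r)) := by gcongr
      _ = 3 / 4 * M := by field_simp; ring
  have hMz : M ≤ 0 := by
    rcases hy.1.eq_or_lt with h0 | h0
    · rw [hM, ← h0]; simp
    · have := hfin y ⟨h0, hy.2⟩
      rw [← hM] at this
      linarith
  intro r hr
  have h1 := hle r hr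
  have h2 : M = 0 := le_antisymm hMz hM0
  rw [h2, zero_div] at h1
  exact abs_nonpos_iff.1 h1

/-- The flux is nonpositive as long as the solution and the potential are nonnegative. -/
theorem flux_nonpos (h : RadialFluxSolution N a u U) {z : ℝ} (hz : z ∈ Ioc (0:ℝ) 1)
    (ha : ∀ᵐ r, r ∈ Ioo (0:ℝ) 1 → 0 ≤ a r)
    (hu : ∀ r ∈ Ioc (0:ℝ) z, 0 ≤ u r) : ∀ r ∈ Ioc (0:ℝ) z, U r ≤ 0 := by
  intro r hr
  rw [h.flux r ⟨hr.1.le, hr.2.trans hz.2⟩, neg_nonpos]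
  apply intervalIntegral.integral_nonneg_of_ae_restrict hr.1.le
  rw [EventuallyLE, ae_restrict_iff' measurableSet_Icc]
  filter_upwards [ha, compl_mem_ae_iff.2 (measure_singleton (0:ℝ)),
    compl_mem_ae_iff.2 (measure_singleton (1:ℝ))] with t h1 h2 h3 ht
  have ht0 : 0 < t := lt_of_le_of_ne ht.1 (Ne.symm h2)
  have ht1 : t < 1 := lt_of_le_of_ne (ht.2.trans (hr.2.trans hz.2)) h3
  have h4 := h1 ⟨ht0, ht1⟩
  have h5 := hu t ⟨ht0, ht.2.trans hr.2⟩
  simp only [Pi.zero_apply]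
  positivity

/-- If the potential is nonnegative and small in a scale-invariant sense on a ball of radius `z`,
a solution positive at `z` is positive on the whole ball. -/
theorem pos_of_small (hN : 3 ≤ N) (h : RadialFluxSolution N a u U) {z : ℝ}
    (hz : z ∈ Ioc (0:ℝ) 1)
    (hfi : IntervalIntegrable (fun t => t ^ (N - 1) * |a t| / √t) volume 0 z)
    (hsmall : ∀ s ∈ Ioc (0:ℝ) z,
      ∫ t in (0:ℝ)..s, t ^ (N - 1) * |a t| / √t ≤ 3 / 8 * (s ^ (N - 2) / √s))
    (ha : ∀ᵐ r, r ∈ Ioo (0:ℝ) 1 → 0 ≤ a r)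
    (huz : 0 < u z) : ∀ r ∈ Ioc (0:ℝ) z, 0 < u r := by
  by_contra! hcon
  obtain ⟨z₀, hz₀, huz₀⟩ := hcon
  have hsub : Icc z₀ z ⊆ Icc 0 1 := Icc_subset_Icc hz₀.1.le hz.2
  have hcont : ContinuousOn u (Icc z₀ z) := h.cont.mono hsub
  have hclosed : IsCompact (Icc z₀ z ∩ u ⁻¹' Iic 0) :=
    isCompact_Icc.of_isClosed_subset (hcont.preimage_isClosed_of_isClosed isClosed_Icc isClosed_Iic)
      inter_subset_left
  obtain ⟨y, ⟨hy, huy⟩, hymax⟩ := hclosed.exists_isGreatest ⟨z₀, left_mem_Icc.2 hz₀.2, huz₀⟩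
  have huy : u y ≤ 0 := huy
  have hyz : y < z := by
    rcases hy.2.eq_or_lt with h1 | h1
    · rw [h1] at huy; linarith
    · exact h1
  have hy0 : 0 < y := hz₀.1.trans_le hy.1
  have hpos : ∀ x ∈ Ioc y z, 0 < u x := by
    intro x hx
    by_contra! hx'
    have := hymax ⟨⟨hy.1.trans hx.1.le, hx.2⟩, hx'⟩
    linarith [hx.1]
  have huy0 : u y = 0 := by
    refine le_antisymm huy ?_
    have h1 : ContinuousWithinAt u (Ioc y z) y :=
      (hcont y hy).mono (Ioc_subset_Icc_self.trans (Icc_subset_Icc_left hy.1))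
    have h2 : y ∈ closure (Ioc y z) := by
      rw [closure_Ioc hyz.ne]; exact left_mem_Icc.2 hyz.le
    have : (nhdsWithin y (Ioc y z)).NeBot := mem_closure_iff_nhdsWithin_neBot.1 h2
    exact ge_of_tendsto h1 (eventually_nhdsWithin_of_forall fun x hx => (hpos x hx).le)
  have hzero := eq_zero_of_small hN h (z := y) ⟨hy0, hy.2.trans hz.2⟩
    (hfi.mono_set (by
      rw [uIcc_of_le hy0.le, uIcc_of_le hz.1.le]; exact Icc_subset_Icc_right hy.2))
    (fun s hs => hsmall s ⟨hs.1, hs.2.trans hy.2⟩) huy0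
  have hUle : ∀ x ∈ Ioc (0:ℝ) z, U x ≤ 0 := h.flux_nonpos hz ha fun t ht => by
    rcases le_or_gt t y with h6 | h6
    · exact (hzero t ⟨ht.1, h6⟩).ge
    · exact (hpos t ⟨h6, ht.2⟩).le
  have h1 := h.sub_eq hy0 hyz.le hz.2
  have h2 : ∫ t in y..z, U t / t ^ (N - 1) ≤ 0 := by
    have : 0 ≤ ∫ t in y..z, -(U t / t ^ (N - 1)) := by
      apply intervalIntegral.integral_nonneg hyz.le
      intro t ht
      have : 0 < t := hy0.trans_le ht.1
      have := div_nonneg (neg_nonneg.2 (hUle t ⟨this, ht.2⟩)) (pow_pos this (N - 1)).le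
      rwa [neg_div] at this
    rw [intervalIntegral.integral_neg] at this
    linarith
  linarith

end RadialFluxSolution

theorem le_add_rpow_mul_rpow {x η q : ℝ} (hx : 0 ≤ x) (hη : 0 < η) (hq : 1 ≤ q) :
    x ≤ η + η ^ (1 - q) * x ^ q := by
  rcases le_or_gt x η with h | h
  · have := mul_nonneg (Real.rpow_nonneg hη.le (1 - q)) (Real.rpow_nonneg hx q)
    linarith
  · have hx0 : 0 < x := hη.trans h
    calc x = x ^ (1 - q) * x ^ q := by rw [← Real.rpow_add hx0]; simp
      _ ≤ η ^ (1 - q) * x ^ q := by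
        apply mul_le_mul_of_nonneg_right _ (Real.rpow_nonneg hx q)
        exact Real.rpow_le_rpow_of_nonpos hη h.le (by linarith)
      _ ≤ _ := by linarith

theorem intervalIntegrable_inv_sqrt (r s : ℝ) :
    IntervalIntegrable (fun t : ℝ => t ^ (-(1/2) : ℝ)) volume r s :=
  intervalIntegral.intervalIntegrable_rpow' (by norm_num)

theorem integral_inv_sqrt (s : ℝ) :
    ∫ t in (0:ℝ)..s, t ^ (-(1/2) : ℝ) = 2 * √s := by
  rw [integral_rpow (Or.inl (by norm_num)), Real.sqrt_eq_rpow]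
  norm_num
  ring

/-- Pointwise bound behind the scale-invariant smallness of a potential in `L^{N/2}`. -/
theorem weighted_potential_le {N : ℕ} (hN : 3 ≤ N) {μ η δ s t x : ℝ} (hμ : 0 ≤ μ) (hη : 0 < η)
    (ht : 0 < t) (hts : t ≤ s) (hsδ : s ≤ δ) :
    t ^ (N - 1) * |x| / √t ≤ s ^ (N - 3) * ((μ * δ ^ 2 + η) * t ^ (-(1/2) : ℝ)
      + η ^ (1 - (N : ℝ) / 2) * √s * (t ^ (N - 1) * |x - μ| ^ ((N : ℝ) / 2))) := by
  have hN' : (3 : ℝ) ≤ N := by exact_mod_cast hN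
  have hst : 0 < √t := Real.sqrt_pos.2 ht
  have hx : |x| ≤ μ + |x - μ| := by
    calc |x| = |μ + (x - μ)| := by ring_nf
      _ ≤ |μ| + |x - μ| := abs_add_le _ _
      _ = _ := by rw [abs_of_nonneg hμ]
  have hpow : (t ^ 2 * |x - μ|) ^ ((N : ℝ) / 2) = t ^ N * |x - μ| ^ ((N : ℝ) / 2) := by
    rw [Real.mul_rpow (by positivity) (abs_nonneg _)]
    congr 1
    rw [← Real.rpow_natCast t 2, ← Real.rpow_mul ht.le, ← Real.rpow_natCast t N]
    congr 1
    push_cast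
    ring
  have hb := le_add_rpow_mul_rpow (x := t ^ 2 * |x - μ|) (by positivity) hη
    (q := (N : ℝ) / 2) (by linarith)
  rw [hpow] at hb
  have hsq : t ^ (-(1/2) : ℝ) = 1 / √t := by
    rw [Real.rpow_neg ht.le, ← Real.sqrt_eq_rpow, one_div]
  have h2 : t ^ 2 * |x| ≤ (μ * δ ^ 2 + η)
      + η ^ (1 - (N : ℝ) / 2) * (t ^ N * |x - μ| ^ ((N : ℝ) / 2)) := by
    have h3 : t ^ 2 * |x| ≤ t ^ 2 * (μ + |x - μ|) := by gcongr
    have h4 : t ^ 2 * μ ≤ μ * δ ^ 2 := by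
      rw [mul_comm]
      have : t ≤ δ := hts.trans hsδ
      gcongr
    linarith
  have e1 : t ^ (N - 1) = t ^ (N - 3) * t ^ 2 := by rw [← pow_add]; congr 1; omega
  have e2 : t ^ N = t ^ (N - 1) * t := by rw [← pow_succ]; congr 1; omega
  set R := |x - μ| ^ ((N : ℝ) / 2) with hR
  have hR0 : 0 ≤ R := Real.rpow_nonneg (abs_nonneg _) _
  set E := η ^ (1 - (N : ℝ) / 2) with hE
  have hE0 : 0 ≤ E := Real.rpow_nonneg hη.le _
  have htt : t / √t = √t := Real.div_sqrt
  have hs0 : 0 < s := ht.trans_le hts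
  have hsplit : ((μ * δ ^ 2 + η) + E * (t ^ (N - 1) * t * R)) / √t
      = (μ * δ ^ 2 + η) * (1 / √t) + E * (t / √t) * (t ^ (N - 1) * R) := by ring
  calc t ^ (N - 1) * |x| / √t = t ^ (N - 3) * ((t ^ 2 * |x|) / √t) := by rw [e1]; ring
    _ ≤ t ^ (N - 3) * (((μ * δ ^ 2 + η) + E * (t ^ N * R)) / √t) := by gcongr
    _ = t ^ (N - 3) * ((μ * δ ^ 2 + η) * (1 / √t) + E * √t * (t ^ (N - 1) * R)) := by
      rw [e2, hsplit, htt]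
    _ ≤ s ^ (N - 3) * ((μ * δ ^ 2 + η) * (1 / √t) + E * √s * (t ^ (N - 1) * R)) := by
      gcongr
    _ = _ := by rw [hsq]

section Potential

variable {N : ℕ} {a : ℝ → ℝ} {μ η δ : ℝ}

theorem intervalIntegrable_weighted_potential (hN : 3 ≤ N) (hμ : 0 ≤ μ) (hη : 0 < η)
    (hδ : δ ∈ Ioc (0:ℝ) 1) (ha : Measurable a)
    (hb : IntervalIntegrable (fun t => t ^ (N - 1) * |a t - μ| ^ ((N : ℝ) / 2)) volume 0 1) :
    IntervalIntegrable (fun t => t ^ (N - 1) * |a t| / √t) volume 0 δ := by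
  have hb' : IntervalIntegrable (fun t => t ^ (N - 1) * |a t - μ| ^ ((N : ℝ) / 2)) volume 0 δ :=
    hb.mono_set (by
      rw [uIcc_of_le hδ.1.le, uIcc_of_le zero_le_one]; exact Icc_subset_Icc_right hδ.2)
  refine IntervalIntegrable.mono_fun' (g := fun t => δ ^ (N - 3) * ((μ * δ ^ 2 + η)
    * t ^ (-(1/2) : ℝ) + η ^ (1 - (N : ℝ) / 2) * √δ
      * (t ^ (N - 1) * |a t - μ| ^ ((N : ℝ) / 2)))) ?_ ?_ ?_
  · exact (((intervalIntegrable_inv_sqrt 0 δ).const_mul _).add (hb'.const_mul _)).const_mul _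
  · exact Measurable.aestronglyMeasurable (by fun_prop)
  · rw [uIoc_of_le hδ.1.le, EventuallyLE, ae_restrict_iff' measurableSet_Ioc]
    refine Eventually.of_forall fun t ht => ?_
    have := weighted_potential_le (x := a t) hN hμ hη ht.1 ht.2 le_rfl
    rw [Real.norm_eq_abs, abs_of_nonneg]
    · exact this
    · have := ht.1
      positivity

theorem integral_weighted_potential_le (hN : 3 ≤ N) (hμ : 0 ≤ μ) (hη : 0 < η)
    (hδ : δ ∈ Ioc (0:ℝ) 1) (ha : Measurable a)
    (hb : IntervalIntegrable (fun t => t ^ (N - 1) * |a t - μ| ^ ((N : ℝ) / 2)) volume 0 1)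
    {s : ℝ} (hs : s ∈ Ioc (0:ℝ) δ) :
    ∫ t in (0:ℝ)..s, t ^ (N - 1) * |a t| / √t ≤ (2 * (μ * δ ^ 2 + η) + η ^ (1 - (N : ℝ) / 2)
      * ∫ t in (0:ℝ)..1, t ^ (N - 1) * |a t - μ| ^ ((N : ℝ) / 2)) * (s ^ (N - 2) / √s) := by
  have hs1 : s ≤ 1 := hs.2.trans hδ.2
  have hb' : IntervalIntegrable (fun t => t ^ (N - 1) * |a t - μ| ^ ((N : ℝ) / 2)) volume 0 s :=
    hb.mono_set (by
      rw [uIcc_of_le hs.1.le, uIcc_of_le zero_le_one]; exact Icc_subset_Icc_right hs1)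
  have hmono : ∫ t in (0:ℝ)..s, t ^ (N - 1) * |a t - μ| ^ ((N : ℝ) / 2)
      ≤ ∫ t in (0:ℝ)..1, t ^ (N - 1) * |a t - μ| ^ ((N : ℝ) / 2) := by
    apply intervalIntegral.integral_mono_interval le_rfl hs.1.le hs1 _ hb
    rw [EventuallyLE, ae_restrict_iff' measurableSet_Ioc]
    refine Eventually.of_forall fun t ht => ?_
    have := ht.1
    simp only [Pi.zero_apply]
    positivity
  have h1 : ∫ t in (0:ℝ)..s, t ^ (N - 1) * |a t| / √t ≤ ∫ t in (0:ℝ)..s,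
      s ^ (N - 3) * ((μ * δ ^ 2 + η) * t ^ (-(1/2) : ℝ)
      + η ^ (1 - (N : ℝ) / 2) * √s * (t ^ (N - 1) * |a t - μ| ^ ((N : ℝ) / 2))) := by
    apply intervalIntegral.integral_mono_on_of_le_Ioo hs.1.le
    · exact (intervalIntegrable_weighted_potential hN hμ hη hδ ha hb).mono_set (by
        rw [uIcc_of_le hs.1.le, uIcc_of_le hδ.1.le]; exact Icc_subset_Icc_right hs.2)
    · exact (((intervalIntegrable_inv_sqrt 0 s).const_mul _).add (hb'.const_mul _)).const_mul _
    · intro t ht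
      exact weighted_potential_le hN hμ hη ht.1 ht.2.le hs.2
  refine h1.trans ?_
  rw [intervalIntegral.integral_const_mul, intervalIntegral.integral_add
    ((intervalIntegrable_inv_sqrt 0 s).const_mul _) (hb'.const_mul _),
    intervalIntegral.integral_const_mul, intervalIntegral.integral_const_mul, integral_inv_sqrt]
  have e : s ^ (N - 2) / √s = s ^ (N - 3) * √s := by
    have : s ^ (N - 2) = s ^ (N - 3) * s := by rw [← pow_succ]; congr 1; omega
    rw [this, mul_div_assoc, Real.div_sqrt]
  rw [e]
  have hE : 0 ≤ η ^ (1 - (N : ℝ) / 2) := Real.rpow_nonneg hη.le _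
  have hs0 := hs.1
  calc _ ≤ s ^ (N - 3) * ((μ * δ ^ 2 + η) * (2 * √s) + η ^ (1 - (N : ℝ) / 2) * √s
        * ∫ t in (0:ℝ)..1, t ^ (N - 1) * |a t - μ| ^ ((N : ℝ) / 2)) := by gcongr
    _ = _ := by ring

theorem pow_mul_le_add {q t x : ℝ} (hq : 1 ≤ q) (hη : 0 < η) (ht : t ∈ Icc (0:ℝ) 1)
    (hx : 0 ≤ x) :
    t ^ (N - 1) * x ≤ η + η ^ (1 - q) * (t ^ (N - 1) * x ^ q) := by
  have h1 := le_add_rpow_mul_rpow hx hη hq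
  have h0 : 0 ≤ t ^ (N - 1) := pow_nonneg ht.1 _
  have h2 : t ^ (N - 1) ≤ 1 := pow_le_one₀ ht.1 ht.2
  nlinarith [mul_le_mul_of_nonneg_left h1 h0]

theorem intervalIntegrable_pow_mul_abs {q : ℝ} {b : ℝ → ℝ} (hq : 1 ≤ q) (hbm : Measurable b)
    (hb : IntervalIntegrable (fun t => t ^ (N - 1) * |b t| ^ q) volume 0 1) :
    IntervalIntegrable (fun t => t ^ (N - 1) * |b t|) volume 0 1 := by
  refine IntervalIntegrable.mono_fun' (g := fun t => 1 + 1 ^ (1 - q)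
    * (t ^ (N - 1) * |b t| ^ q)) ?_ ?_ ?_
  · exact intervalIntegrable_const.add (hb.const_mul _)
  · exact Measurable.aestronglyMeasurable (by fun_prop)
  · rw [uIoc_of_le zero_le_one, EventuallyLE, ae_restrict_iff' measurableSet_Ioc]
    refine Eventually.of_forall fun t ht => ?_
    have := pow_mul_le_add (N := N) hq one_pos ⟨ht.1.le, ht.2⟩ (abs_nonneg (b t))
    rw [Real.norm_eq_abs, abs_of_nonneg]
    · exact this
    · have := ht.1
      positivity

theorem integral_pow_mul_abs_le {q : ℝ} {b : ℝ → ℝ} (hq : 1 ≤ q) (hη : 0 < η) (hbm : Measurable b)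
    (hb : IntervalIntegrable (fun t => t ^ (N - 1) * |b t| ^ q) volume 0 1) :
    ∫ t in (0:ℝ)..1, t ^ (N - 1) * |b t|
      ≤ η + η ^ (1 - q) * ∫ t in (0:ℝ)..1, t ^ (N - 1) * |b t| ^ q := by
  calc ∫ t in (0:ℝ)..1, t ^ (N - 1) * |b t|
      ≤ ∫ t in (0:ℝ)..1, (η + η ^ (1 - q) * (t ^ (N - 1) * |b t| ^ q)) := by
        apply intervalIntegral.integral_mono_on zero_le_one
          (intervalIntegrable_pow_mul_abs hq hbm hb)
          (intervalIntegrable_const.add (hb.const_mul _))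
        exact fun t ht => pow_mul_le_add hq hη ht (abs_nonneg _)
    _ = _ := by
        rw [intervalIntegral.integral_add intervalIntegrable_const (hb.const_mul _),
          intervalIntegral.integral_const_mul]
        simp

end Potential

theorem abs_integral_le_of_abs_le {f g : ℝ → ℝ} {r s : ℝ} (hrs : r ≤ s)
    (hg : IntervalIntegrable g volume r s) (h : ∀ t ∈ Ioc r s, |f t| ≤ g t) :
    |∫ t in r..s, f t| ≤ ∫ t in r..s, g t := by
  rw [← Real.norm_eq_abs]
  exact intervalIntegral.norm_integral_le_of_norm_le hrs (Eventually.of_forall h) hg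

theorem not_nontrivialSol_of_eq_zero {u : ℝ → ℝ} (hu : ContinuousOn u (Icc 0 1))
    (h : ∀ r ∈ Ioc (0:ℝ) 1, u r = 0) : ¬ NontrivialSol u := by
  rintro ⟨r, hr, hne⟩
  rcases eq_or_lt_of_le hr.1 with h0 | h0
  · subst h0
    have hc : ContinuousWithinAt u (Ioc 0 1) 0 := (hu 0 hr).mono Ioc_subset_Icc_self
    have hm : (0:ℝ) ∈ closure (Ioc (0:ℝ) 1) := by
      rw [closure_Ioc zero_ne_one]; exact hr
    exact hne (by simpa using hc.mem_closure hm (t := {0}) (fun x hx => h x hx))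
  · exact hne (h r ⟨h0, hr.2⟩)

namespace RadialFluxSolution

variable {N : ℕ} {μ : ℝ} {a u U φ Φ : ℝ → ℝ}

theorem zero (hμ : IntervalIntegrable (fun s => s ^ (N - 1) * a s) volume 0 1) :
    RadialFluxSolution N a (fun _ => 0) (fun _ => 0) where
  cont := continuousOn_const
  deriv r _ := by simpa using hasDerivAt_const r (0:ℝ)
  int := hμ
  flux r _ := by simp
  neumann := rfl

/-- Away from the origin, two solutions agreeing at the boundary are close if their potentials
are close in the weighted `L¹` sense. -/
theorem abs_sub_add_abs_sub_le (hφ : RadialFluxSolution N (fun _ => μ) φ Φ)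
    (hu : RadialFluxSolution N a u U) (hμ : 0 ≤ μ) (h1 : u 1 = φ 1) {δ : ℝ} (hδ : δ ∈ Ioc (0:ℝ) 1)
    (hb : IntervalIntegrable (fun t => t ^ (N - 1) * |a t - μ|) volume 0 1) {ε B : ℝ}
    (hε : ∫ t in (0:ℝ)..1, t ^ (N - 1) * |a t - μ| ≤ ε)
    (hB : ∀ r ∈ Icc δ 1, |φ r| ≤ B)
    (hsmall : 2 * ε * Real.exp (2 * ((δ ^ (N - 1))⁻¹ + μ)) ≤ 1 / 2) :
    ∀ r ∈ Icc δ 1, |u r - φ r| + |U r - Φ r|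
      ≤ 4 * ε * Real.exp (2 * ((δ ^ (N - 1))⁻¹ + μ)) * B := by
  set K := (δ ^ (N - 1))⁻¹ + μ with hK
  have hδ0 : 0 < δ := hδ.1
  have hδp : 0 < (δ ^ (N - 1))⁻¹ := by positivity
  have hK0 : 0 < K := by positivity
  have hsub : Icc δ 1 ⊆ Icc (0:ℝ) 1 := Icc_subset_Icc_left hδ0.le
  have hB0 : 0 ≤ B := (abs_nonneg _).trans (hB 1 ⟨hδ.2, le_rfl⟩)
  have hε0 : 0 ≤ ε := by
    refine le_trans (intervalIntegral.integral_nonneg zero_le_one fun t ht => ?_) hε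
    have := ht.1
    positivity
  have hwc : ContinuousOn (fun r => |u r - φ r|) (Icc δ 1) :=
    ((hu.cont.sub hφ.cont).mono hsub).abs
  have hVc : ContinuousOn (fun r => |U r - Φ r|) (Icc δ 1) :=
    ((hu.flux_cont.sub hφ.flux_cont).mono hsub).abs
  have hfi : ∀ {f : ℝ → ℝ}, ContinuousOn f (Icc δ 1) → ∀ r ∈ Icc δ 1,
      IntervalIntegrable f volume r 1 := fun hf r hr =>
    (hf.mono (Icc_subset_Icc_left hr.1)).intervalIntegrable_of_Icc hr.2
  obtain ⟨y, hy, hmax⟩ := isCompact_Icc.exists_isMaxOn (nonempty_Icc.2 hδ.2) hwc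
  set Y := |u y - φ y| with hY
  have hY0 : 0 ≤ Y := abs_nonneg _
  have hYle : ∀ x ∈ Icc δ 1, |u x - φ x| ≤ Y := fun x hx => hmax hx
  have hone : (1:ℝ) ∈ Icc (0:ℝ) 1 := ⟨zero_le_one, le_rfl⟩
  have hmain : ∀ x ∈ Icc δ 1, |u x - φ x| + |U x - Φ x|
      ≤ 2 * (ε * (B + Y)) * Real.exp (2 * K * (1 - δ)) := by
    refine gronwall_integral_right hδ.2 (hwc.add hVc) (fun x _ => by positivity)
      (by positivity) hK0 fun x hx => ?_
    have hx0 : 0 < x := hδ0.trans_le hx.1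
    have e1 : u x - φ x = -∫ t in x..1, (U t - Φ t) / t ^ (N - 1) := by
      have g1 := hu.sub_eq hx0 hx.2 le_rfl
      have g2 := hφ.sub_eq hx0 hx.2 le_rfl
      have i1 := hfi ((hu.deriv_cont hδ0)) x hx
      have i2 := hfi ((hφ.deriv_cont hδ0)) x hx
      simp only [sub_div]
      rw [intervalIntegral.integral_sub i1 i2, ← g1, ← g2, h1]
      ring
    have b1 : |u x - φ x| ≤ (δ ^ (N - 1))⁻¹ * ∫ t in x..1, |U t - Φ t| := by
      rw [e1, abs_neg, ← intervalIntegral.integral_const_mul]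
      refine abs_integral_le_of_abs_le hx.2
        ((hfi hVc x hx).const_mul _) fun t ht => ?_
      have htδ : δ ≤ t := hx.1.trans ht.1.le
      rw [abs_div, abs_of_nonneg (pow_nonneg (hδ0.le.trans htδ) _),
        div_eq_inv_mul]
      gcongr
    have e2 : U x - Φ x = ∫ t in x..1, (t ^ (N - 1) * a t * u t - t ^ (N - 1) * μ * φ t) := by
      have g1 := hu.flux_sub (hsub hx) hone
      have g2 := hφ.flux_sub (hsub hx) hone
      rw [intervalIntegral.integral_sub (hu.int_mul_sub (hsub hx) hone)
        (hφ.int_mul_sub (hsub hx) hone)]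
      rw [hu.neumann] at g1
      rw [hφ.neumann] at g2
      linarith
    have hb' : IntervalIntegrable (fun t => t ^ (N - 1) * |a t - μ|) volume x 1 :=
      hb.mono_set (by
        rw [uIcc_of_le hx.2, uIcc_of_le zero_le_one]; exact Icc_subset_Icc_left hx0.le)
    have hbx : ∫ t in x..1, t ^ (N - 1) * |a t - μ| ≤ ε := by
      refine le_trans ?_ hε
      apply intervalIntegral.integral_mono_interval hx0.le hx.2 le_rfl _ hb
      rw [EventuallyLE, ae_restrict_iff' measurableSet_Ioc]
      refine Eventually.of_forall fun t ht => ?_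
      have := ht.1
      simp only [Pi.zero_apply]
      positivity
    have b2 : |U x - Φ x| ≤ μ * (∫ t in x..1, |u t - φ t|) + ε * (B + Y) := by
      have : |U x - Φ x| ≤ ∫ t in x..1, (μ * |u t - φ t| + (B + Y) * (t ^ (N - 1) * |a t - μ|)) := by
        rw [e2]
        refine abs_integral_le_of_abs_le hx.2
          (((hfi hwc x hx).const_mul _).add (hb'.const_mul _)) fun t ht => ?_
        have ht' : t ∈ Icc δ 1 := ⟨hx.1.trans ht.1.le, ht.2⟩
        have ht0 : 0 ≤ t := hδ0.le.trans ht'.1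
        have hut : |u t| ≤ B + Y := by
          have c1 := hB t ht'
          have c2 := hYle t ht'
          calc |u t| = |φ t + (u t - φ t)| := by ring_nf
            _ ≤ |φ t| + |u t - φ t| := abs_add_le _ _
            _ ≤ _ := by linarith
        have hp0 : 0 ≤ t ^ (N - 1) := pow_nonneg ht0 _
        have hp1 : t ^ (N - 1) ≤ 1 := pow_le_one₀ ht0 ht'.2
        calc |t ^ (N - 1) * a t * u t - t ^ (N - 1) * μ * φ t|
            = |t ^ (N - 1) * (μ * (u t - φ t)) + t ^ (N - 1) * (a t - μ) * u t| := by ring_nf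
          _ ≤ |t ^ (N - 1) * (μ * (u t - φ t))| + |t ^ (N - 1) * (a t - μ) * u t| :=
            abs_add_le _ _
          _ = t ^ (N - 1) * (μ * |u t - φ t|) + t ^ (N - 1) * |a t - μ| * |u t| := by
            simp only [abs_mul, abs_of_nonneg hp0, abs_of_nonneg hμ]
          _ ≤ 1 * (μ * |u t - φ t|) + t ^ (N - 1) * |a t - μ| * (B + Y) := by gcongr
          _ = _ := by ring
      rw [intervalIntegral.integral_add ((hfi hwc x hx).const_mul _) (hb'.const_mul _),
        intervalIntegral.integral_const_mul, intervalIntegral.integral_const_mul] at this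
      have h2 : (B + Y) * ∫ t in x..1, t ^ (N - 1) * |a t - μ| ≤ (B + Y) * ε := by gcongr
      linarith
    have e3 : ∫ t in x..1, (|u t - φ t| + |U t - Φ t|)
        = (∫ t in x..1, |u t - φ t|) + ∫ t in x..1, |U t - Φ t| :=
      intervalIntegral.integral_add (hfi hwc x hx) (hfi hVc x hx)
    have n1 : 0 ≤ ∫ t in x..1, |u t - φ t| :=
      intervalIntegral.integral_nonneg hx.2 fun t _ => abs_nonneg _
    have n2 : 0 ≤ ∫ t in x..1, |U t - Φ t| :=
      intervalIntegral.integral_nonneg hx.2 fun t _ => abs_nonneg _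
    rw [e3, hK]
    nlinarith [mul_nonneg hδp.le n1, mul_nonneg hμ n2]
  have hexp : Real.exp (2 * K * (1 - δ)) ≤ Real.exp (2 * K) := by
    apply Real.exp_le_exp.2
    nlinarith
  set E := Real.exp (2 * K) with hE
  have hmain' : ∀ x ∈ Icc δ 1, |u x - φ x| + |U x - Φ x| ≤ 2 * ε * E * (B + Y) := by
    intro x hx
    calc _ ≤ _ := hmain x hx
      _ ≤ 2 * (ε * (B + Y)) * E := by gcongr
      _ = _ := by ring
  have hYB : Y ≤ B := by
    have h2 := hmain' y hy
    have h3 : 2 * ε * E * (B + Y) ≤ 1 / 2 * (B + Y) := by gcongr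
    have h4 := abs_nonneg (U y - Φ y)
    linarith
  intro r hr
  have hE0 : 0 ≤ E := (Real.exp_pos _).le
  calc _ ≤ _ := hmain' r hr
    _ ≤ 2 * ε * E * (B + B) := by gcongr
    _ = _ := by ring

/-- A solution vanishing at the boundary vanishes away from the origin, if the potential is
close to a constant one. -/
theorem eq_zero_of_boundary (hu : RadialFluxSolution N a u U) (hμ : 0 ≤ μ) (h1 : u 1 = 0)
    {δ : ℝ} (hδ : δ ∈ Ioc (0:ℝ) 1)
    (hb : IntervalIntegrable (fun t => t ^ (N - 1) * |a t - μ|) volume 0 1)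
    (hsmall : 2 * (∫ t in (0:ℝ)..1, t ^ (N - 1) * |a t - μ|)
      * Real.exp (2 * ((δ ^ (N - 1))⁻¹ + μ)) ≤ 1 / 2) :
    ∀ r ∈ Icc δ 1, u r = 0 := by
  intro r hr
  have h0 : RadialFluxSolution N (fun _ => μ) (fun _ => 0) (fun _ => 0) :=
    zero (Continuous.intervalIntegrable (by fun_prop) _ _)
  have := abs_sub_add_abs_sub_le h0 hu hμ h1 hδ hb (B := 0) le_rfl (by simp) hsmall r hr
  have h2 := abs_nonneg (U r - 0)
  have h3 := abs_nonneg (u r - 0)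
  have h4 : |u r - 0| = 0 := by linarith
  simpa using h4

theorem boundary_ne_zero (hφ : RadialFluxSolution N (fun _ => μ) φ Φ) (hμ : 0 ≤ μ)
    (hnt : NontrivialSol φ) :
    φ 1 ≠ 0 := by
  intro h1
  have hpos : ∀ r ∈ Ioc (0:ℝ) 1, φ r = 0 := fun r hr =>
    hφ.eq_zero_of_boundary hμ h1 hr (by simp) (by norm_num) r ⟨le_rfl, hr.2⟩
  exact not_nontrivialSol_of_eq_zero hφ.cont hpos hnt

/-- A nontrivial solution and its flux have no common zero away from the origin. -/
theorem value_or_flux_ne_zero (hφ : RadialFluxSolution N (fun _ => μ) φ Φ) (hμ : 0 ≤ μ)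
    (hnt : NontrivialSol φ) {r : ℝ} (hr : r ∈ Ioc (0:ℝ) 1) :
    φ r ≠ 0 ∨ Φ r ≠ 0 := by
  by_contra! hcon
  obtain ⟨z1, z2⟩ := hcon
  apply hφ.boundary_ne_zero hμ hnt
  have hsub : Icc r 1 ⊆ Icc (0:ℝ) 1 := Icc_subset_Icc_left hr.1.le
  have hwc : ContinuousOn (fun r => |φ r|) (Icc r 1) := (hφ.cont.mono hsub).abs
  have hVc : ContinuousOn (fun r => |Φ r|) (Icc r 1) := (hφ.flux_cont.mono hsub).abs
  have hr0 := hr.1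
  have hp : 0 < (r ^ (N - 1))⁻¹ := by positivity
  have key := gronwall_integral_left_zero (f := fun x => |φ x| + |Φ x|)
    (K := (r ^ (N - 1))⁻¹ + μ) hr.2 (hwc.add hVc) (fun x _ => by positivity) (by positivity)
    (by
      intro x hx
      have hfi : ∀ {f : ℝ → ℝ}, ContinuousOn f (Icc r 1) → IntervalIntegrable f volume r x :=
        fun hf => (hf.mono (Icc_subset_Icc_right hx.2)).intervalIntegrable_of_Icc hx.1
      have b1 : |φ x| ≤ (r ^ (N - 1))⁻¹ * ∫ t in r..x, |Φ t| := by
        have g := hφ.sub_eq hr0 hx.1 hx.2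
        rw [z1, sub_zero] at g
        rw [g, ← intervalIntegral.integral_const_mul]
        refine abs_integral_le_of_abs_le hx.1 ((hfi hVc).const_mul _) fun t ht => ?_
        have htr : r ≤ t := ht.1.le
        rw [abs_div, abs_of_nonneg (pow_nonneg (hr0.le.trans htr) _),
          div_eq_inv_mul]
        gcongr
      have b2 : |Φ x| ≤ μ * ∫ t in r..x, |φ t| := by
        have g := hφ.flux_sub ⟨hr0.le, hr.2⟩ (hsub hx)
        rw [z2, sub_zero] at g
        rw [g, abs_neg, ← intervalIntegral.integral_const_mul]
        refine abs_integral_le_of_abs_le hx.1 ((hfi hwc).const_mul _) fun t ht => ?_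
        have ht0 : 0 ≤ t := hr0.le.trans ht.1.le
        have hp1 : t ^ (N - 1) ≤ 1 := pow_le_one₀ ht0 (ht.2.trans hx.2)
        have hp0 : 0 ≤ t ^ (N - 1) := pow_nonneg ht0 _
        rw [abs_mul, abs_mul, abs_of_nonneg hp0, abs_of_nonneg hμ]
        have : 0 ≤ μ * |φ t| := by positivity
        nlinarith
      rw [intervalIntegral.integral_add (hfi hwc) (hfi hVc)]
      have n1 : 0 ≤ ∫ t in r..x, |φ t| :=
        intervalIntegral.integral_nonneg hx.1 fun t _ => abs_nonneg _
      have n2 : 0 ≤ ∫ t in r..x, |Φ t| :=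
        intervalIntegral.integral_nonneg hx.1 fun t _ => abs_nonneg _
      nlinarith [mul_nonneg hp.le n1, mul_nonneg hμ n2]) 1 ⟨hr.2, le_rfl⟩
  have h2 := abs_nonneg (Φ 1)
  have h3 := abs_nonneg (φ 1)
  have h4 : |φ 1| = 0 := by linarith
  simpa using h4

end RadialFluxSolution

/-- The flux Wronskian is controlled by the product of the two solutions when the two phase
vectors form an acute angle. -/
theorem neg_mul_le_abs_wronskian_half {u U φ Φ : ℝ} (hD : 0 < u * φ + U * Φ) :
    -(u * φ) ≤ |U * φ - u * Φ| / 2 := by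
  set W := U * φ - u * Φ with hW
  have hρ : 0 < u ^ 2 + U ^ 2 := by
    by_contra! h
    have h1 : u = 0 := by nlinarith [sq_nonneg u, sq_nonneg U]
    have h2 : U = 0 := by nlinarith [sq_nonneg u, sq_nonneg U]
    simp [h1, h2] at hD
  have e : u * φ * (u ^ 2 + U ^ 2) = u ^ 2 * (u * φ + U * Φ) + u * U * W := by
    rw [hW]; ring
  have h1 : 0 ≤ u ^ 2 * (u * φ + U * Φ) := by positivity
  have h2 : |u * U * W| ≤ (u ^ 2 + U ^ 2) / 2 * |W| := by
    rw [abs_mul]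
    gcongr
    rw [abs_le]
    constructor <;> nlinarith [sq_nonneg (u + U), sq_nonneg (u - U)]
  have h3 := neg_abs_le (u * U * W)
  by_contra! hc
  nlinarith [mul_lt_mul_of_pos_right hc hρ]

theorem mul_pos_of_wronskian_eq_zero {u U φ Φ : ℝ} (hD : 0 < u * φ + U * Φ)
    (hW : U * φ - u * Φ = 0) (hφ : φ ≠ 0) : 0 < u * φ := by
  have e : u * φ * (u ^ 2 + U ^ 2) = u ^ 2 * (u * φ + U * Φ) + u * U * (U * φ - u * Φ) := by
    ring
  rw [hW, mul_zero, add_zero] at e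
  have hu : u ≠ 0 := by
    rintro rfl
    have : U = 0 := by simpa [hφ] using hW
    simp [this] at hD
  have h1 : 0 < u ^ 2 * (u * φ + U * Φ) := by positivity
  rw [← e] at h1
  exact pos_of_mul_pos_left h1 (by positivity)

namespace RadialFluxSolution

variable {N : ℕ} {μ : ℝ} {a u U φ Φ : ℝ → ℝ}

theorem wronskian_sub (hφ : RadialFluxSolution N (fun _ => μ) φ Φ)
    (hu : RadialFluxSolution N a u U) {r s : ℝ} (hr : 0 < r) (hrs : r ≤ s) (hs : s ≤ 1) :
    (U s * φ s - u s * Φ s) - (U r * φ r - u r * Φ r)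
      = ∫ t in r..s, t ^ (N - 1) * (a t - μ) * -(u t * φ t) := by
  have hr' : r ∈ Icc (0:ℝ) 1 := ⟨hr.le, hrs.trans hs⟩
  have hs' : s ∈ Icc (0:ℝ) 1 := ⟨hr.le.trans hrs, hs⟩
  have hsub : Icc r s ⊆ Icc (0:ℝ) 1 := Icc_subset_Icc hr.le hs
  have hd : ∀ {v V b : ℝ → ℝ}, RadialFluxSolution N b v V →
      IntervalIntegrable (fun t => V t / t ^ (N - 1)) volume r s := fun h =>
    ((h.deriv_cont hr).mono (Icc_subset_Icc_right hs)).intervalIntegrable_of_Icc hrs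
  have hV : ∀ {v V b : ℝ → ℝ}, RadialFluxSolution N b v V → ∀ x ∈ Icc r s,
      V x = V r + ∫ t in r..x, -(t ^ (N - 1) * b t * v t) := fun h x hx => by
    rw [intervalIntegral.integral_neg]
    linarith [h.flux_sub hr' (hsub hx)]
  have hv : ∀ {v V b : ℝ → ℝ}, RadialFluxSolution N b v V → ∀ x ∈ Icc r s,
      v x = v r + ∫ t in r..x, V t / t ^ (N - 1) := fun h x hx => by
    linarith [h.sub_eq hr hx.1 (hx.2.trans hs)]
  have hc : ∀ {v V b : ℝ → ℝ}, RadialFluxSolution N b v V → ContinuousOn v (uIcc r s) :=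
    fun h => by rw [uIcc_of_le hrs]; exact h.cont.mono hsub
  have hC : ∀ {v V b : ℝ → ℝ}, RadialFluxSolution N b v V → ContinuousOn V (uIcc r s) :=
    fun h => by rw [uIcc_of_le hrs]; exact h.flux_cont.mono hsub
  have iu := (hu.int_mul_sub hr' hs').neg
  have iφ := (hφ.int_mul_sub hr' hs').neg
  have p1 := integral_mul_add_mul_of_primitive hrs iu (hd hφ) (hV hu) (hv hφ)
  have p2 := integral_mul_add_mul_of_primitive hrs (hd hu) iφ (hv hu) (hV hφ)
  have e : (U s * φ s - u s * Φ s) - (U r * φ r - u r * Φ r)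
      = (U s * φ s - U r * φ r) - (u s * Φ s - u r * Φ r) := by ring
  rw [e, p1, p2, ← intervalIntegral.integral_sub
    ((iu.mul_continuousOn (hc hφ)).add ((hd hφ).continuousOn_mul (hC hu)))
    (((hd hu).mul_continuousOn (hC hφ)).add (iφ.continuousOn_mul (hc hu)))]
  apply intervalIntegral.integral_congr
  intro t _
  simp only [Pi.neg_apply]
  ring

/-- If the phase vectors of two solutions always form an acute angle and one potential dominates
the other with a small weighted `L¹` difference, the potentials agree where `φ` is nonzero. -/
theorem potential_eq_of_acute (hφ : RadialFluxSolution N (fun _ => μ) φ Φ)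
    (hu : RadialFluxSolution N a u U)
    (hb : IntervalIntegrable (fun t => t ^ (N - 1) * |a t - μ|) volume 0 1)
    (hb1 : ∫ t in (0:ℝ)..1, t ^ (N - 1) * |a t - μ| ≤ 1)
    (ha : ∀ᵐ r, r ∈ Ioo (0:ℝ) 1 → μ ≤ a r)
    (hD : ∀ r ∈ Ioc (0:ℝ) 1, 0 < u r * φ r + U r * Φ r) :
    ∀ᵐ r, r ∈ Ioo (0:ℝ) 1 → φ r ≠ 0 → a r = μ := by
  set W : ℝ → ℝ := fun r => U r * φ r - u r * Φ r with hW
  have hWc : ContinuousOn W (Icc 0 1) :=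
    (hu.flux_cont.mul hφ.cont).sub (hu.cont.mul hφ.flux_cont)
  have hsubI : ∀ {r s : ℝ}, 0 < r → r ≤ s → s ≤ 1 → IntervalIntegrable
      (fun t => t ^ (N - 1) * (a t - μ) * -(u t * φ t)) volume r s := fun {r s} hr hrs hs => by
    have hr' : r ∈ Icc (0:ℝ) 1 := ⟨hr.le, hrs.trans hs⟩
    have hs' : s ∈ Icc (0:ℝ) 1 := ⟨hr.le.trans hrs, hs⟩
    have hc : ContinuousOn φ (uIcc r s) := hφ.cont.mono (uIcc_subset_Icc hr' hs')
    have hc' : ContinuousOn u (uIcc r s) := hu.cont.mono (uIcc_subset_Icc hr' hs')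
    have h1 := ((hu.int_mul_sub hr' hs').mul_continuousOn hc.neg).sub
      ((hφ.int_mul_sub hr' hs').mul_continuousOn hc'.neg)
    exact h1.congr fun t _ => by simp only [Pi.neg_apply]; ring
  obtain ⟨y, hy, hmax⟩ := isCompact_Icc.exists_isMaxOn (nonempty_Icc.2 zero_le_one) hWc.abs
  set M := |W y| with hM
  have hM0 : 0 ≤ M := abs_nonneg _
  have hle : ∀ x ∈ Icc (0:ℝ) 1, |W x| ≤ M := fun x hx => hmax hx
  have hstep : ∀ r ∈ Ioc (0:ℝ) 1, ∀ s ∈ Icc r 1, W s - W r ≤ M / 2 := by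
    intro r hr s hs
    have hb' : IntervalIntegrable (fun t => t ^ (N - 1) * |a t - μ|) volume r s :=
      hb.mono_set (by
        rw [uIcc_of_le hs.1, uIcc_of_le zero_le_one]; exact Icc_subset_Icc hr.1.le hs.2)
    have hbx : ∫ t in r..s, t ^ (N - 1) * |a t - μ| ≤ 1 := by
      refine le_trans ?_ hb1
      apply intervalIntegral.integral_mono_interval hr.1.le hs.1 hs.2 _ hb
      rw [EventuallyLE, ae_restrict_iff' measurableSet_Ioc]
      refine Eventually.of_forall fun t ht => ?_
      have := ht.1
      simp only [Pi.zero_apply]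
      positivity
    calc W s - W r = _ := hφ.wronskian_sub hu hr.1 hs.1 hs.2
      _ ≤ ∫ t in r..s, M / 2 * (t ^ (N - 1) * |a t - μ|) := by
        apply intervalIntegral.integral_mono_ae_restrict hs.1 (hsubI hr.1 hs.1 hs.2)
          (hb'.const_mul _)
        rw [EventuallyLE, ae_restrict_iff' measurableSet_Icc]
        filter_upwards [ha, compl_mem_ae_iff.2 (measure_singleton (1:ℝ))] with t h1 h3 ht
        have ht0 : 0 < t := hr.1.trans_le ht.1
        have ht1 : t < 1 := lt_of_le_of_ne (ht.2.trans hs.2) h3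
        have h4 := h1 ⟨ht0, ht1⟩
        rw [abs_of_nonneg (sub_nonneg.2 h4)]
        have h5 := neg_mul_le_abs_wronskian_half (hD t ⟨ht0, ht1.le⟩)
        have h6 := hle t ⟨ht0.le, ht1.le⟩
        have h7 : 0 ≤ t ^ (N - 1) * (a t - μ) := mul_nonneg (by positivity) (sub_nonneg.2 h4)
        rw [mul_comm (M / 2)]
        apply mul_le_mul_of_nonneg_left _ h7
        simp only [hW] at h6
        linarith
      _ = M / 2 * ∫ t in r..s, t ^ (N - 1) * |a t - μ| :=
        intervalIntegral.integral_const_mul _ _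
      _ ≤ M / 2 * 1 := by gcongr
      _ = _ := mul_one _
  have hW0 : W 0 = 0 := by simp [hW, hu.flux_zero, hφ.flux_zero]
  have hW1 : W 1 = 0 := by simp [hW, hu.neumann, hφ.neumann]
  have hstep0 : ∀ s ∈ Ioc (0:ℝ) 1, W s - W 0 ≤ M / 2 := by
    intro s hs
    have hc : ContinuousWithinAt (fun r => W s - W r) (Ioc 0 s) 0 :=
      (continuousOn_const.sub hWc 0 ⟨le_rfl, zero_le_one⟩).mono
        (fun x hx => ⟨hx.1.le, hx.2.trans hs.2⟩)
    refine hc.closure_le ?_ continuousWithinAt_const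
      (fun r hr => hstep r ⟨hr.1, hr.2.trans hs.2⟩ s ⟨hr.2, hs.2⟩)
    rw [closure_Ioc hs.1.ne]
    exact ⟨le_rfl, hs.1.le⟩
  have hMz : M = 0 := by
    rcases eq_or_lt_of_le hy.1 with h0 | h0
    · rw [hM, ← h0, hW0, abs_zero]
    · have c1 := hstep0 y ⟨h0, hy.2⟩
      have c2 := hstep y ⟨h0, hy.2⟩ 1 ⟨hy.2, le_rfl⟩
      rw [hW0] at c1
      rw [hW1] at c2
      have : M ≤ M / 2 := abs_le.2 ⟨by linarith, by linarith⟩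
      linarith
  have hWz : ∀ x ∈ Icc (0:ℝ) 1, W x = 0 := fun x hx => by
    have := hle x hx
    rw [hMz] at this
    exact abs_nonpos_iff.1 this
  have hnn : ∀ t ∈ Ioc (0:ℝ) 1, 0 ≤ u t * φ t := fun t ht => by
    have h5 := neg_mul_le_abs_wronskian_half (hD t ht)
    have h6 : U t * φ t - u t * Φ t = 0 := hWz t ⟨ht.1.le, ht.2⟩
    rw [h6, abs_zero] at h5
    linarith
  have hae : ∀ n : ℕ, ∀ᵐ t, t ∈ Ioc (1 / ((n:ℝ) + 1)) 1 →
      t ^ (N - 1) * (a t - μ) * (u t * φ t) = 0 := by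
    intro n
    set r : ℝ := 1 / ((n:ℝ) + 1) with hr
    have hr0 : 0 < r := by positivity
    have hr1 : r ≤ 1 := by
      rw [hr, div_le_one (by positivity)]
      linarith [n.cast_nonneg (α := ℝ)]
    have key := hφ.wronskian_sub hu hr0 hr1 le_rfl
    have h1 : U 1 * φ 1 - u 1 * Φ 1 = 0 := hW1
    have h2 : U r * φ r - u r * Φ r = 0 := hWz r ⟨hr0.le, hr1⟩
    have hfi := (hsubI hr0 hr1 le_rfl).neg
    have e : (-fun t => t ^ (N - 1) * (a t - μ) * -(u t * φ t))
        = fun t => t ^ (N - 1) * (a t - μ) * (u t * φ t) := by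
      funext t; simp
    rw [e] at hfi
    have e2 : ∫ t in r..1, t ^ (N - 1) * (a t - μ) * (u t * φ t) = 0 := by
      have : ∫ t in r..1, t ^ (N - 1) * (a t - μ) * (u t * φ t)
          = -∫ t in r..1, t ^ (N - 1) * (a t - μ) * -(u t * φ t) := by
        rw [← intervalIntegral.integral_neg]
        congr 1
        funext t; ring
      rw [this, ← key, h1, h2]; simp
    rw [intervalIntegral.integral_eq_zero_iff_of_le_of_nonneg_ae hr1 ?_ hfi] at e2
    · rw [EventuallyEq, ae_restrict_iff' measurableSet_Ioc] at e2
      exact e2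
    · rw [EventuallyLE, ae_restrict_iff' measurableSet_Ioc]
      filter_upwards [ha, compl_mem_ae_iff.2 (measure_singleton (1:ℝ))] with t h1 h3 ht
      have ht0 : 0 < t := hr0.trans ht.1
      have ht1 : t < 1 := lt_of_le_of_ne ht.2 h3
      have h4 := sub_nonneg.2 (h1 ⟨ht0, ht1⟩)
      have h5 := hnn t ⟨ht0, ht.2⟩
      simp only [Pi.zero_apply]
      positivity
  filter_upwards [ae_all_iff.2 hae] with t ht ht01 hne
  obtain ⟨n, hn⟩ := exists_nat_one_div_lt ht01.1
  have h1 := ht n ⟨hn, ht01.2.le⟩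
  have h2 := mul_pos_of_wronskian_eq_zero (hD t ⟨ht01.1, ht01.2.le⟩)
    (hWz t ⟨ht01.1.le, ht01.2.le⟩) hne
  have h3 : t ^ (N - 1) ≠ 0 := pow_ne_zero _ ht01.1.ne'
  have h4 := (mul_eq_zero.1 h1).resolve_right h2.ne'
  exact sub_eq_zero.1 ((mul_eq_zero.1 h4).resolve_left h3)

end RadialFluxSolution

open scoped Topology

section Smallness

variable {N : ℕ} {μ δ : ℝ} {a : ℝ → ℝ}

theorem weighted_potential_small (hN : 3 ≤ N) (hμ : 0 ≤ μ) (hδ : δ ∈ Ioc (0:ℝ) 1)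
    (hμδ : μ * δ ^ 2 ≤ 1 / 16) (ha : Measurable a)
    (hb : IntervalIntegrable (fun t => t ^ (N - 1) * |a t - μ| ^ ((N : ℝ) / 2)) volume 0 1)
    (hI : (1 / 16 : ℝ) ^ (1 - (N : ℝ) / 2)
      * ∫ t in (0:ℝ)..1, t ^ (N - 1) * |a t - μ| ^ ((N : ℝ) / 2) ≤ 1 / 8) :
    ∀ s ∈ Ioc (0:ℝ) δ,
      ∫ t in (0:ℝ)..s, t ^ (N - 1) * |a t| / √t ≤ 3 / 8 * (s ^ (N - 2) / √s) := by
  intro s hs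
  refine (integral_weighted_potential_le hN hμ (by norm_num : (0:ℝ) < 1 / 16) hδ ha hb hs).trans ?_
  have hs0 := hs.1
  apply mul_le_mul_of_nonneg_right _ (by positivity)
  linarith

end Smallness

namespace RadialFluxSolution

variable {N : ℕ} {μ : ℝ} {φ Φ : ℝ → ℝ}

theorem ne_zero_of_small_radius (hN : 3 ≤ N) (hφ : RadialFluxSolution N (fun _ => μ) φ Φ)
    (hμ : 0 ≤ μ) (hnt : NontrivialSol φ) {δ : ℝ} (hδ : δ ∈ Ioc (0:ℝ) 1)
    (hμδ : μ * δ ^ 2 ≤ 1 / 16) : φ δ ≠ 0 := by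
  intro h0
  have hN0 : (N : ℝ) / 2 ≠ 0 := by
    have : (3:ℝ) ≤ N := by exact_mod_cast hN
    positivity
  have hb : IntervalIntegrable (fun t : ℝ => t ^ (N - 1) * |μ - μ| ^ ((N : ℝ) / 2)) volume 0 1 := by
    simp [Real.zero_rpow hN0]
  have hz := hφ.eq_zero_of_small hN hδ
    (intervalIntegrable_weighted_potential hN hμ one_pos hδ measurable_const hb)
    (weighted_potential_small hN hμ hδ hμδ measurable_const hb (by simp [Real.zero_rpow hN0])) h0
  rcases hφ.value_or_flux_ne_zero hμ hnt hδ with h | h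
  · exact h h0
  · apply h
    rw [hφ.flux δ ⟨hδ.1.le, hδ.2⟩, neg_eq_zero, intervalIntegral.integral_of_le hδ.1.le]
    refine (setIntegral_congr_fun (g := fun _ => (0:ℝ)) measurableSet_Ioc fun t ht => ?_).trans
      (by simp)
    simp [hz t ht]

theorem exists_lower_bound_of_pos (hN : 3 ≤ N) (hφ : RadialFluxSolution N (fun _ => μ) φ Φ)
    (hμ : 0 ≤ μ) (hnt : NontrivialSol φ) (hφ0 : ∀ᵐ r, r ∈ Ioo (0:ℝ) 1 → φ r ≠ 0) {δ : ℝ}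
    (hδ : δ ∈ Ioc (0:ℝ) 1) (hμδ : μ * δ ^ 2 ≤ 1 / 16) (hφδ : 0 < φ δ) :
    ∃ ε > 0, ∀ a u U : ℝ → ℝ, Measurable a → (∀ᵐ r, r ∈ Ioo (0:ℝ) 1 → μ ≤ a r) →
      IntervalIntegrable (fun t => t ^ (N - 1) * |a t - μ| ^ ((N : ℝ) / 2)) volume 0 1 →
      RadialFluxSolution N a u U → NontrivialSol u →
      ∫ t in (0:ℝ)..1, t ^ (N - 1) * |a t - μ| ^ ((N : ℝ) / 2) < ε →
      ∀ᵐ r, r ∈ Ioo (0:ℝ) 1 → a r = μ := by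
  have hq : 1 ≤ (N : ℝ) / 2 := by
    have : (3:ℝ) ≤ N := by exact_mod_cast hN
    linarith
  have hN0 : (N : ℝ) / 2 ≠ 0 := (zero_lt_one.trans_le hq).ne'
  have hsub : Icc δ 1 ⊆ Icc (0:ℝ) 1 := Icc_subset_Icc_left hδ.1.le
  have hφc := hφ.cont.mono hsub
  have hΦc := hφ.flux_cont.mono hsub
  have hne : (Icc δ 1).Nonempty := nonempty_Icc.2 hδ.2
  obtain ⟨y, hy, hymin⟩ := isCompact_Icc.exists_isMinOn hne ((hφc.pow 2).add (hΦc.pow 2))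
  set m := φ y ^ 2 + Φ y ^ 2 with hm
  have hm0 : 0 < m := by
    rw [hm]
    rcases hφ.value_or_flux_ne_zero hμ hnt ⟨hδ.1.trans_le hy.1, hy.2⟩ with h | h <;> positivity
  have hmle : ∀ r ∈ Icc δ 1, m ≤ φ r ^ 2 + Φ r ^ 2 := fun r hr => hymin hr
  obtain ⟨B, hB⟩ := isCompact_Icc.exists_bound_of_continuousOn (hφc.abs.add hΦc.abs)
  have hB' : ∀ r ∈ Icc δ 1, |φ r| + |Φ r| ≤ B := fun r hr => by
    exact (le_abs_self _).trans (hB r hr)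
  have hB0 : 0 ≤ B := (add_nonneg (abs_nonneg _) (abs_nonneg _)).trans (hB' 1 ⟨hδ.2, le_rfl⟩)
  set E := Real.exp (2 * ((δ ^ (N - 1))⁻¹ + μ)) with hE
  have hE0 : 0 < E := Real.exp_pos _
  obtain ⟨ε₁, ⟨⟨⟨⟨h1, h2⟩, h3⟩, h4⟩, hε₁⟩⟩ : ∃ x : ℝ, (((x < 1 ∧ 2 * x * E < 1 / 2) ∧
      4 * x * E * B < φ δ) ∧ 4 * x * E * B * B < m) ∧ 0 < x := by
    have l : ∀ {f : ℝ → ℝ} {c : ℝ}, Continuous f → f 0 = 0 → 0 < c → ∀ᶠ x in 𝓝[>] 0, f x < c :=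
      fun hf h0 hc => ((hf.tendsto' 0 0 h0).mono_left nhdsWithin_le_nhds).eventually_lt_const hc
    exact ((((l (f := fun x => x) (by fun_prop) rfl one_pos).and
      (l (f := fun x => 2 * x * E) (by fun_prop) (by simp) (by norm_num))).and
      (l (f := fun x => 4 * x * E * B) (by fun_prop) (by simp) hφδ)).and
      (l (f := fun x => 4 * x * E * B * B) (by fun_prop) (by simp) hm0)).and
      self_mem_nhdsWithin |>.exists
  set C₁ := (1 / 16 : ℝ) ^ (1 - (N : ℝ) / 2) with hC₁
  set C₂ := (ε₁ / 2) ^ (1 - (N : ℝ) / 2) with hC₂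
  have hC₁0 : 0 < C₁ := Real.rpow_pos_of_pos (by norm_num) _
  have hC₂0 : 0 < C₂ := Real.rpow_pos_of_pos (by positivity) _
  refine ⟨min (1 / 8 / C₁) (ε₁ / 2 / C₂), by positivity, fun a v V ham ha hb hv hvnt hI => ?_⟩
  have hI1 := (lt_min_iff.1 hI).1
  have hI2 := (lt_min_iff.1 hI).2
  rw [lt_div_iff₀' hC₁0] at hI1
  rw [lt_div_iff₀' hC₂0] at hI2
  have hbm : Measurable fun t => a t - μ := by fun_prop
  have hb1 := intervalIntegrable_pow_mul_abs hq hbm hb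
  have hJ : ∫ t in (0:ℝ)..1, t ^ (N - 1) * |a t - μ| ≤ ε₁ := by
    have := integral_pow_mul_abs_le hq (half_pos hε₁) hbm hb
    linarith
  have hfi := intervalIntegrable_weighted_potential hN hμ one_pos hδ ham hb
  have hsm := weighted_potential_small hN hμ hδ hμδ ham hb hI1.le
  have hb0 : IntervalIntegrable (fun t : ℝ => t ^ (N - 1) * |μ - μ| ^ ((N : ℝ) / 2)) volume 0 1 := by
    simp [Real.zero_rpow hN0]
  have hfiφ := intervalIntegrable_weighted_potential hN hμ one_pos hδ measurable_const hb0
  have hsmφ := weighted_potential_small hN hμ hδ hμδ measurable_const hb0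
    (by simp [Real.zero_rpow hN0])
  have ha0 : ∀ᵐ r, r ∈ Ioo (0:ℝ) 1 → 0 ≤ a r := by
    filter_upwards [ha] with r hr h01 using hμ.trans (hr h01)
  have hv1 : v 1 ≠ 0 := by
    intro h0
    have hJE : 2 * (∫ t in (0:ℝ)..1, t ^ (N - 1) * |a t - μ|) * E ≤ 1 / 2 :=
      le_trans (by gcongr) h2.le
    have hz := hv.eq_zero_of_boundary hμ h0 hδ hb1 hJE
    have hz' := hv.eq_zero_of_small hN hδ hfi hsm (hz δ ⟨le_rfl, hδ.2⟩)
    refine not_nontrivialSol_of_eq_zero hv.cont (fun r hr => ?_) hvnt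
    rcases le_total r δ with h | h
    · exact hz' r ⟨hr.1, h⟩
    · exact hz r ⟨h, hr.2⟩
  have hu := hv.smul (φ 1 / v 1)
  set u : ℝ → ℝ := fun r => φ 1 / v 1 * v r with hudef
  set U : ℝ → ℝ := fun r => φ 1 / v 1 * V r
  have hu1 : u 1 = φ 1 := by rw [hudef]; field_simp
  have hclose := hφ.abs_sub_add_abs_sub_le hu hμ hu1 hδ hb1 hJ
    (fun r hr => (le_add_of_nonneg_right (abs_nonneg _)).trans (hB' r hr)) h2.le
  rw [← hE] at hclose
  have huδ : 0 < u δ := by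
    have c1 := hclose δ ⟨le_rfl, hδ.2⟩
    have c2 := neg_abs_le (u δ - φ δ)
    have c3 := abs_nonneg (U δ - Φ δ)
    linarith
  have hupos := hu.pos_of_small hN hδ hfi hsm ha0 huδ
  have hφpos := hφ.pos_of_small hN hδ hfiφ hsmφ (Eventually.of_forall fun _ _ => hμ) hφδ
  have hUneg := hu.flux_nonpos hδ ha0 (fun r hr => (hupos r hr).le)
  have hΦneg := hφ.flux_nonpos hδ (Eventually.of_forall fun _ _ => hμ) (fun r hr => (hφpos r hr).le)
  have hD : ∀ r ∈ Ioc (0:ℝ) 1, 0 < u r * φ r + U r * Φ r := by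
    intro r hr
    rcases le_total r δ with h | h
    · have c1 := mul_pos (hupos r ⟨hr.1, h⟩) (hφpos r ⟨hr.1, h⟩)
      have c2 := mul_nonneg_of_nonpos_of_nonpos (hUneg r ⟨hr.1, h⟩) (hΦneg r ⟨hr.1, h⟩)
      linarith
    · have c1 := hclose r ⟨h, hr.2⟩
      have c2 := hmle r ⟨h, hr.2⟩
      have c3 := hB' r ⟨h, hr.2⟩
      have e : u r * φ r + U r * Φ r
          = φ r ^ 2 + Φ r ^ 2 + ((u r - φ r) * φ r + (U r - Φ r) * Φ r) := by ring
      have c4 : |(u r - φ r) * φ r + (U r - Φ r) * Φ r| ≤ 4 * ε₁ * E * B * B := by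
        calc _ ≤ |(u r - φ r) * φ r| + |(U r - Φ r) * Φ r| := abs_add_le _ _
          _ = |u r - φ r| * |φ r| + |U r - Φ r| * |Φ r| := by rw [abs_mul, abs_mul]
          _ ≤ |u r - φ r| * B + |U r - Φ r| * B := by
            gcongr
            · linarith [abs_nonneg (Φ r)]
            · linarith [abs_nonneg (φ r)]
          _ = (|u r - φ r| + |U r - Φ r|) * B := by ring
          _ ≤ _ := by gcongr
      have c5 := neg_le_of_abs_le c4
      linarith
  filter_upwards [hφ.potential_eq_of_acute hu hb1 (hJ.trans h1.le) ha hD, hφ0] with r hr hr0 h01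
  exact hr h01 (hr0 h01)

/-- A potential dominating `μ` which is resonant and close to `μ` in `L^{N/2}` is equal to `μ`. -/
theorem exists_lower_bound (hN : 3 ≤ N) (hφ : RadialFluxSolution N (fun _ => μ) φ Φ)
    (hμ : 0 ≤ μ) (hnt : NontrivialSol φ) (hφ0 : ∀ᵐ r, r ∈ Ioo (0:ℝ) 1 → φ r ≠ 0) :
    ∃ ε > 0, ∀ a u U : ℝ → ℝ, Measurable a → (∀ᵐ r, r ∈ Ioo (0:ℝ) 1 → μ ≤ a r) →
      IntervalIntegrable (fun t => t ^ (N - 1) * |a t - μ| ^ ((N : ℝ) / 2)) volume 0 1 →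
      RadialFluxSolution N a u U → NontrivialSol u →
      ∫ t in (0:ℝ)..1, t ^ (N - 1) * |a t - μ| ^ ((N : ℝ) / 2) < ε →
      ∀ᵐ r, r ∈ Ioo (0:ℝ) 1 → a r = μ := by
  set δ : ℝ := 1 / (4 * (μ + 1)) with hδdef
  have hδ : δ ∈ Ioc (0:ℝ) 1 := by
    refine ⟨by positivity, ?_⟩
    rw [hδdef, div_le_one (by positivity)]
    linarith
  have hμδ : μ * δ ^ 2 ≤ 1 / 16 := by
    rw [hδdef, div_pow, one_pow, mul_one_div, div_le_div_iff₀ (by positivity) (by norm_num)]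
    nlinarith
  have hne := hφ.ne_zero_of_small_radius hN hμ hnt hδ hμδ
  have hinv := inv_ne_zero hne
  refine (hφ.smul (φ δ)⁻¹).exists_lower_bound_of_pos hN hμ ?_ ?_ hδ hμδ ?_
  · obtain ⟨r, hr, h⟩ := hnt
    exact ⟨r, hr, mul_ne_zero hinv h⟩
  · filter_upwards [hφ0] with r hr h01 using mul_ne_zero hinv (hr h01)
  · simp [inv_mul_cancel₀ hne]

end RadialFluxSolution

theorem HasDerivAt.ite_le {f g f' g' : ℝ → ℝ} {c x : ℝ} (hf : x ≤ c → HasDerivAt f (f' x) x)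
    (hg : c ≤ x → HasDerivAt g (g' x) x) (h : f c = g c) (h' : f' c = g' c) :
    HasDerivAt (fun x => if x ≤ c then f x else g x) (if x ≤ c then f' x else g' x) x := by
  rcases lt_trichotomy x c with hx | hx | hx
  · rw [if_pos hx.le]
    refine (hf hx.le).congr_of_eventuallyEq ?_
    filter_upwards [Iic_mem_nhds hx] with y hy
    exact if_pos hy
  · subst hx
    rw [if_pos le_rfl]
    have h1 : HasDerivWithinAt (fun y => if y ≤ x then f y else g y) (f' x) (Iic x) x :=
      (hf le_rfl).hasDerivWithinAt.congr (fun y hy => if_pos hy) (if_pos le_rfl)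
    have h2 : HasDerivWithinAt (fun y => if y ≤ x then f y else g y) (f' x) (Ici x) x := by
      rw [h']
      refine (hg le_rfl).hasDerivWithinAt.congr (fun y hy => ?_) (by simp [h])
      rcases eq_or_lt_of_le (mem_Ici.1 hy) with e | e
      · simp [← e, h]
      · exact if_neg e.not_ge
    simpa using h1.union h2
  · rw [if_neg hx.not_ge]
    refine (hg hx.le).congr_of_eventuallyEq ?_
    filter_upwards [Ioi_mem_nhds hx] with y hy
    exact if_neg (not_le.2 hy)

theorem ContinuousOn.ite_le {f g : ℝ → ℝ} {α β c : ℝ} (hα : α ≤ c) (hβ : c ≤ β)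
    (hf : ContinuousOn f (Icc α c)) (hg : ContinuousOn g (Icc c β)) (h : f c = g c) :
    ContinuousOn (fun x => if x ≤ c then f x else g x) (Icc α β) := by
  rw [← Icc_union_Icc_eq_Icc hα hβ]
  refine ContinuousOn.union_of_isClosed ?_ ?_ isClosed_Icc isClosed_Icc
  · exact hf.congr fun x hx => if_pos hx.2
  · refine hg.congr fun x hx => ?_
    rcases eq_or_lt_of_le hx.1 with e | e
    · simp [← e, h]
    · exact if_neg e.not_ge

/-- A solution `u` of the radial equation with flux `U = r^(N-1) u'` on an interval `[α, β]`,
for a potential which is regular outside a countable set. -/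
structure LocalFluxSolution (N : ℕ) (α β : ℝ) (a u U : ℝ → ℝ) : Prop where
  cont : ContinuousOn u (Icc α β)
  flux_cont : ContinuousOn U (Icc α β)
  deriv : ∀ r ∈ Icc α β, 0 < r → HasDerivAt u (U r / r ^ (N - 1)) r
  flux_deriv : ∃ S : Set ℝ, S.Countable ∧
    ∀ r ∈ Ioo α β \ S, HasDerivAt U (-(r ^ (N - 1) * a r * u r)) r

namespace LocalFluxSolution

variable {N : ℕ} {α β : ℝ} {a u U : ℝ → ℝ}

theorem mono (h : LocalFluxSolution N α β a u U) {α' β' : ℝ} (hα : α ≤ α') (hβ : β' ≤ β) :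
    LocalFluxSolution N α' β' a u U where
  cont := h.cont.mono (Icc_subset_Icc hα hβ)
  flux_cont := h.flux_cont.mono (Icc_subset_Icc hα hβ)
  deriv r hr := h.deriv r (Icc_subset_Icc hα hβ hr)
  flux_deriv := by
    obtain ⟨S, hS, hd⟩ := h.flux_deriv
    exact ⟨S, hS, fun r hr => hd r ⟨Ioo_subset_Ioo hα hβ hr.1, hr.2⟩⟩

theorem glue {c : ℝ} {b v V : ℝ → ℝ} (h : LocalFluxSolution N α c a u U)
    (k : LocalFluxSolution N c β b v V) (hα : α ≤ c) (hβ : c ≤ β) (huv : u c = v c)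
    (hUV : U c = V c) :
    LocalFluxSolution N α β (fun x => if x ≤ c then a x else b x)
      (fun x => if x ≤ c then u x else v x) (fun x => if x ≤ c then U x else V x) where
  cont := h.cont.ite_le hα hβ k.cont huv
  flux_cont := h.flux_cont.ite_le hα hβ k.flux_cont hUV
  deriv r hr hr0 := by
    have := HasDerivAt.ite_le (f' := fun x => U x / x ^ (N - 1)) (g' := fun x => V x / x ^ (N - 1))
      (fun hx => h.deriv r ⟨hr.1, hx⟩ hr0) (fun hx => k.deriv r ⟨hx, hr.2⟩ hr0) huv (by rw [hUV])
    rwa [← ite_div] at this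
  flux_deriv := by
    obtain ⟨S, hS, hd⟩ := h.flux_deriv
    obtain ⟨T, hT, kd⟩ := k.flux_deriv
    refine ⟨insert c (S ∪ T), (hS.union hT).insert c, fun r hr => ?_⟩
    simp only [Set.mem_sdiff, mem_insert_iff, mem_union, not_or] at hr
    obtain ⟨hr, hrc, hrS, hrT⟩ := hr
    rcases lt_or_gt_of_ne hrc with hlt | hgt
    · simp only [if_pos hlt.le]
      refine (hd r ⟨⟨hr.1, hlt⟩, hrS⟩).congr_of_eventuallyEq ?_
      filter_upwards [Iic_mem_nhds hlt] with y hy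
      exact if_pos hy
    · simp only [if_neg hgt.not_ge]
      refine (kd r ⟨⟨hgt, hr.2⟩, hrT⟩).congr_of_eventuallyEq ?_
      filter_upwards [Ioi_mem_nhds hgt] with y hy
      exact if_neg (not_le.2 hy)

theorem rescale (h : LocalFluxSolution N α β a u U) {l : ℝ} (hl : 0 < l) (κ : ℝ) :
    LocalFluxSolution N (α / l) (β / l) (fun r => l ^ 2 * a (l * r)) (fun r => κ * u (l * r))
      (fun r => κ * l / l ^ (N - 1) * U (l * r)) where
  cont := (h.cont.comp (by fun_prop) fun r hr => by
    rw [mem_Icc, div_le_iff₀' hl, le_div_iff₀' hl] at hr; exact hr).const_mul κ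
  flux_cont := (h.flux_cont.comp (by fun_prop) fun r hr => by
    rw [mem_Icc, div_le_iff₀' hl, le_div_iff₀' hl] at hr; exact hr).const_mul _
  deriv r hr hr0 := by
    rw [mem_Icc, div_le_iff₀' hl, le_div_iff₀' hl] at hr
    have h1 := (h.deriv (l * r) hr (by positivity)).comp r ((hasDerivAt_id r).const_mul l)
    refine (h1.const_mul κ).congr_deriv ?_
    rw [mul_pow]
    field_simp
  flux_deriv := by
    obtain ⟨S, hS, hd⟩ := h.flux_deriv
    refine ⟨(fun r => l * r) ⁻¹' S, hS.preimage (mul_right_injective₀ hl.ne'), fun r hr => ?_⟩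
    obtain ⟨hr, hrS⟩ := hr
    rw [mem_Ioo, div_lt_iff₀' hl, lt_div_iff₀' hl] at hr
    have h1 := (hd (l * r) ⟨hr, hrS⟩).comp r ((hasDerivAt_id r).const_mul l)
    refine (h1.const_mul (κ * l / l ^ (N - 1))).congr_deriv ?_
    rw [mul_pow]
    field_simp

theorem radialFluxSolution (h : LocalFluxSolution N 0 1 a u U)
    (ha : IntervalIntegrable (fun s => s ^ (N - 1) * a s) volume 0 1) (h0 : U 0 = 0)
    (h1 : U 1 = 0) : RadialFluxSolution N a u U where
  cont := h.cont
  deriv r hr := h.deriv r ⟨hr.1.le, hr.2⟩ hr.1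
  int := ha
  flux r hr := by
    obtain ⟨S, hS, hd⟩ := h.flux_deriv
    have hsub : uIcc 0 r ⊆ Icc (0:ℝ) 1 := by
      rw [uIcc_of_le hr.1]; exact Icc_subset_Icc_right hr.2
    have hfi : IntervalIntegrable (fun s => s ^ (N - 1) * a s * u s) volume 0 r :=
      (ha.mono_set (by rwa [uIcc_of_le zero_le_one])).mul_continuousOn (h.cont.mono hsub)
    have key := MeasureTheory.integral_eq_of_hasDerivAt_off_countable U
      (fun s => -(s ^ (N - 1) * a s * u s)) hS (h.flux_cont.mono hsub)
      (fun x hx => hd x ⟨by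
        have h2 := hx.1
        rw [min_eq_left hr.1, max_eq_right hr.1] at h2
        exact ⟨h2.1, h2.2.trans_le hr.2⟩, hx.2⟩) hfi.neg
    rw [intervalIntegral.integral_neg, h0, sub_zero] at key
    exact key.symm
  neumann := h1

end LocalFluxSolution

theorem RadialFluxSolution.localFluxSolution {N : ℕ} {μ : ℝ} {φ Φ : ℝ → ℝ}
    (h : RadialFluxSolution N (fun _ => μ) φ Φ) :
    LocalFluxSolution N 0 1 (fun _ => μ) φ Φ where
  cont := h.cont
  flux_cont := h.flux_cont
  deriv r hr hr0 := h.deriv r ⟨hr0, hr.2⟩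
  flux_deriv := by
    refine ⟨∅, countable_empty, fun r hr => ?_⟩
    have hr' := hr.1
    have hc : ContinuousOn (fun s => s ^ (N - 1) * μ * φ s) (Icc 0 1) :=
      ContinuousOn.mul (by fun_prop) h.cont
    have hmem : Ioo (0:ℝ) 1 ∈ 𝓝 r := Ioo_mem_nhds hr'.1 hr'.2
    have h1 : HasDerivAt (fun x => ∫ s in (0:ℝ)..x, s ^ (N - 1) * μ * φ s)
        (r ^ (N - 1) * μ * φ r) r := by
      refine intervalIntegral.integral_hasDerivAt_right
        (h.int_mul_sub ⟨le_rfl, zero_le_one⟩ ⟨hr'.1.le, hr'.2.le⟩) ?_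
        (hc.continuousAt (Icc_mem_nhds hr'.1 hr'.2))
      exact (hc.mono Ioo_subset_Icc_self).stronglyMeasurableAtFilter isOpen_Ioo r hr'
    refine h1.neg.congr_of_eventuallyEq ?_
    filter_upwards [hmem] with x hx
    exact h.flux x ⟨hx.1.le, hx.2.le⟩

/-- Oscillating solutions of the Euler equation with a supercritical inverse-square potential. -/
theorem localFluxSolution_inverse_square {N : ℕ} (hN : 3 ≤ N) {m ρ σ : ℝ}
    (hm : m = ((N : ℝ) - 2) / 2) (hσ : 0 < σ) (hρ : 0 < ρ) (A B : ℝ) :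
    LocalFluxSolution N σ ρ (fun r => (m ^ 2 + 1) / r ^ 2)
      (fun r => Real.exp (-m * Real.log (r / ρ)) *
        (A * Real.cos (Real.log (r / ρ)) + B * Real.sin (Real.log (r / ρ))))
      (fun r => r ^ (N - 2) * (Real.exp (-m * Real.log (r / ρ)) *
        ((B - m * A) * Real.cos (Real.log (r / ρ))
          - (A + m * B) * Real.sin (Real.log (r / ρ))))) := by
  have hlog : ∀ r : ℝ, 0 < r → HasDerivAt (fun r => Real.log (r / ρ)) (1 / r) r := by
    intro r hr
    refine (((hasDerivAt_id r).div_const ρ).log (by positivity)).congr_deriv ?_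
    simp only [id]
    field_simp
  have hgen : ∀ (A B r : ℝ), 0 < r → HasDerivAt (fun r => Real.exp (-m * Real.log (r / ρ)) *
        (A * Real.cos (Real.log (r / ρ)) + B * Real.sin (Real.log (r / ρ))))
        (Real.exp (-m * Real.log (r / ρ)) * ((B - m * A) * Real.cos (Real.log (r / ρ))
          - (A + m * B) * Real.sin (Real.log (r / ρ))) / r) r := by
    intro A B r hr
    have h := hlog r hr
    refine ((h.const_mul (-m)).exp.mul ((h.cos.const_mul A).add (h.sin.const_mul B))).congr_deriv ?_
    simp only [Pi.add_apply]
    ring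
  have hflux : ∀ r : ℝ, 0 < r → HasDerivAt (fun r => r ^ (N - 2) *
      (Real.exp (-m * Real.log (r / ρ)) * ((B - m * A) * Real.cos (Real.log (r / ρ))
        - (A + m * B) * Real.sin (Real.log (r / ρ)))))
      (-(r ^ (N - 1) * ((m ^ 2 + 1) / r ^ 2) * (Real.exp (-m * Real.log (r / ρ)) *
        (A * Real.cos (Real.log (r / ρ)) + B * Real.sin (Real.log (r / ρ)))))) r := by
    intro r hr
    have h := ((hasDerivAt_id r).pow (N - 2)).mul (hgen (B - m * A) (-(A + m * B)) r hr)
    have e : (fun r => r ^ (N - 2) * (Real.exp (-m * Real.log (r / ρ)) *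
        ((B - m * A) * Real.cos (Real.log (r / ρ)) - (A + m * B) * Real.sin (Real.log (r / ρ)))))
        = (id ^ (N - 2)) * (fun r => Real.exp (-m * Real.log (r / ρ)) *
        ((B - m * A) * Real.cos (Real.log (r / ρ))
          + -(A + m * B) * Real.sin (Real.log (r / ρ)))) := by
      funext x
      simp only [Pi.mul_apply, Pi.pow_apply, id]
      ring
    rw [e]
    refine h.congr_deriv ?_
    obtain ⟨n, rfl⟩ : ∃ n, N = n + 3 := ⟨N - 3, by omega⟩
    have hn : (n : ℝ) = 2 * m - 1 := by rw [hm]; push_cast; ring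
    simp only [id, Pi.pow_apply, show n + 3 - 2 = n + 1 by omega, show n + 3 - 1 = n + 2 by omega,
      show n + 1 - 1 = n by omega]
    push_cast
    rw [hn]
    field_simp
    ring
  refine ⟨?_, ?_, ?_, ?_⟩
  · exact fun r hr => (hgen A B r (hσ.trans_le hr.1)).continuousAt.continuousWithinAt
  · exact fun r hr => (hflux r (hσ.trans_le hr.1)).continuousAt.continuousWithinAt
  · intro r _ hr
    refine (hgen A B r hr).congr_deriv ?_
    have e : r ^ (N - 1) = r ^ (N - 2) * r := by rw [← pow_succ]; congr 1; omega
    rw [e]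
    field_simp
  · exact ⟨∅, countable_empty, fun r hr => hflux r (hσ.trans hr.1.1)⟩

theorem RadialFluxSolution.exists_concentrated {N : ℕ} (hN : 3 ≤ N) {μ : ℝ} {φ Φ : ℝ → ℝ}
    (h : RadialFluxSolution N (fun _ => μ) φ Φ) (hμ : 0 ≤ μ) (hnt : NontrivialSol φ) :
    ∃ C > 0, ∀ ρ ∈ Ioo (0:ℝ) 1, μ * ρ ^ 2 < 1 → ∃ a u U : ℝ → ℝ, Measurable a ∧
      RadialFluxSolution N a u U ∧ NontrivialSol u ∧ (∀ r ∈ Ioo (0:ℝ) 1, μ ≤ a r) ∧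
      (∀ r ∈ Ioo (0:ℝ) 1, a r ≤ μ + C / ρ ^ 2) ∧ (∀ r ∈ Ioc ρ 1, a r = μ) ∧
      0 < volume {r ∈ Ioo (0:ℝ) 1 | μ < a r} := by
  set m : ℝ := ((N : ℝ) - 2) / 2 with hm
  set l : ℝ := Real.exp Real.pi with hl
  have hl1 : 1 < l := Real.one_lt_exp_iff.2 Real.pi_pos
  have hl0 : 0 < l := Real.exp_pos _
  refine ⟨(m ^ 2 + 1) * l ^ 2, by positivity, fun ρ hρ hμρ => ?_⟩
  have hρ0 : 0 < ρ := hρ.1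
  set σ : ℝ := ρ / l with hσ
  have hσ0 : 0 < σ := by positivity
  have hσρ : σ < ρ := div_lt_self hρ0 hl1
  set A := φ ρ with hA
  set B := m * A + Φ ρ / ρ ^ (N - 2) with hB
  set κ := -Real.exp (m * Real.pi) with hκ
  have hlN : l ^ (N - 2) = Real.exp (m * Real.pi) ^ 2 := by
    rw [hl, ← Real.exp_nat_mul, ← Real.exp_nat_mul, Nat.cast_sub (by omega), hm]
    congr 1
    push_cast
    ring
  have hin := (h.localFluxSolution.mono le_rfl hρ.2.le).rescale hl0 κ
  rw [zero_div, ← hσ] at hin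
  have hmid := localFluxSolution_inverse_square hN hm hσ0 hρ0 A B
  have hout := h.localFluxSolution.mono hρ.1.le le_rfl
  have hlogρ : Real.log (ρ / ρ) = 0 := by rw [div_self hρ0.ne', Real.log_one]
  have hlogσ : Real.log (σ / ρ) = -Real.pi := by
    rw [hσ, div_div, mul_comm, ← div_div, div_self hρ0.ne', one_div, Real.log_inv, hl,
      Real.log_exp]
  have hlσ : l * σ = ρ := by rw [hσ]; field_simp
  have hright := hmid.glue hout hσρ.le hρ.2.le (by simp [hlogρ, hA]) (by
    simp only [hlogρ, hB]
    simp
    field_simp)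
  have hfull := hin.glue hright hσ0.le (hσρ.le.trans hρ.2.le)
    (by simp [hσρ.le, hlogσ, hlσ, hA, hκ]) (by
      simp only [hσρ.le, if_true, hlogσ, hlσ, hκ, hB]
      have e1 : l ^ (N - 1) = l ^ (N - 2) * l := by rw [← pow_succ]; congr 1; omega
      have e2 : σ ^ (N - 2) = ρ ^ (N - 2) / Real.exp (m * Real.pi) ^ 2 := by
        rw [hσ, div_pow, hlN]
      rw [e1, e2, hlN]
      simp
      field_simp)
  set a : ℝ → ℝ := fun r => if r ≤ σ then l ^ 2 * μ else if r ≤ ρ then (m ^ 2 + 1) / r ^ 2 else μ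
    with ha
  have ham : Measurable a :=
    Measurable.ite measurableSet_Iic measurable_const
      (Measurable.ite measurableSet_Iic (by fun_prop) measurable_const)
  have hlow : ∀ r ∈ Ioo (0:ℝ) 1, μ ≤ a r := by
    intro r hr
    simp only [ha]
    split_ifs with h1 h2
    · nlinarith [one_lt_pow₀ hl1 two_ne_zero]
    · rw [le_div_iff₀ (by have := hr.1; positivity)]
      have : r ^ 2 ≤ ρ ^ 2 := by have := hr.1; gcongr
      nlinarith [sq_nonneg m]
    · exact le_rfl
  have hup : ∀ r ∈ Ioo (0:ℝ) 1, a r ≤ μ + (m ^ 2 + 1) * l ^ 2 / ρ ^ 2 := by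
    intro r hr
    have hC : 0 ≤ (m ^ 2 + 1) * l ^ 2 / ρ ^ 2 := by positivity
    simp only [ha]
    split_ifs with h1 h2
    · have : l ^ 2 * μ ≤ (m ^ 2 + 1) * l ^ 2 / ρ ^ 2 := by
        rw [le_div_iff₀ (by positivity)]
        have h3 : 0 ≤ l ^ 2 := by positivity
        have h4 : 0 ≤ l ^ 2 * m ^ 2 := by positivity
        nlinarith
      linarith
    · have : (m ^ 2 + 1) / r ^ 2 ≤ (m ^ 2 + 1) * l ^ 2 / ρ ^ 2 := by
        have h3 : (m ^ 2 + 1) * l ^ 2 / ρ ^ 2 = (m ^ 2 + 1) / σ ^ 2 := by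
          rw [hσ]; field_simp
        rw [h3]
        have : σ ≤ r := (not_le.1 h1).le
        gcongr
      linarith
    · linarith
  have hsol := hfull.radialFluxSolution (by
    refine IntervalIntegrable.mono_fun' (g := fun _ => μ + (m ^ 2 + 1) * l ^ 2 / ρ ^ 2)
      intervalIntegrable_const ((by fun_prop : Measurable fun s => s ^ (N - 1) * a s).aestronglyMeasurable) ?_
    rw [uIoc_of_le zero_le_one, EventuallyLE, ae_restrict_iff' measurableSet_Ioc]
    filter_upwards [compl_mem_ae_iff.2 (measure_singleton (1:ℝ))] with t ht1 ht
    have ht' : t ∈ Ioo (0:ℝ) 1 := ⟨ht.1, lt_of_le_of_ne ht.2 ht1⟩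
    have h1 := hup t ht'
    have h2 := hμ.trans (hlow t ht')
    have h3 : t ^ (N - 1) ≤ 1 := pow_le_one₀ ht.1.le ht.2
    have h4 : 0 ≤ t ^ (N - 1) := pow_nonneg ht.1.le _
    change ‖t ^ (N - 1) * a t‖ ≤ _
    rw [Real.norm_eq_abs, abs_of_nonneg (mul_nonneg h4 h2)]
    nlinarith) (by simp [hσ0.le, h.flux_zero])
    (by simp [(hσρ.trans hρ.2).not_ge, hρ.2.not_ge, h.neumann])
  refine ⟨a, _, _, ham, hsol, ⟨1, ⟨zero_le_one, le_rfl⟩, ?_⟩, hlow, hup, ?_, ?_⟩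
  · simpa [(hσρ.trans hρ.2).not_ge, hρ.2.not_ge] using h.boundary_ne_zero hμ hnt
  · intro r hr
    simp [ha, (hσρ.trans hr.1).not_ge, hr.1.not_ge]
  · refine lt_of_lt_of_le (b := volume (Ioo σ ρ)) (by simp [hσρ]) (measure_mono fun r hr => ?_)
    have hr0 : 0 < r := hσ0.trans hr.1
    refine ⟨⟨hr0, hr.2.trans hρ.2⟩, ?_⟩
    simp only [ha, hr.1.not_ge, hr.2.le, if_false, if_true]
    rw [lt_div_iff₀ (by positivity)]
    have : r ^ 2 ≤ ρ ^ 2 := by have := hr.2.le; gcongr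
    nlinarith [sq_nonneg m]

theorem omegaN_pos {N : ℕ} (hN : 0 < N) : 0 < omegaN N :=
  mul_pos (by exact_mod_cast hN)
    (ENNReal.toReal_pos (Metric.measure_ball_pos _ _ one_pos).ne' measure_ball_lt_top.ne)

theorem radialLpNorm_nonneg (N : ℕ) (p : ℝ) (a : ℝ → ℝ) : 0 ≤ radialLpNorm N p a := by
  refine Real.rpow_nonneg (mul_nonneg (by unfold omegaN; positivity) ?_) _
  refine intervalIntegral.integral_nonneg zero_le_one fun t ht => ?_
  have := ht.1
  positivity

theorem radialMemLp_iff {N : ℕ} {p : ℝ} {a : ℝ → ℝ} : RadialMemLp N p a ↔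
    IntervalIntegrable (fun r => r ^ (N - 1) * |a r| ^ p) volume 0 1 :=
  (intervalIntegrable_iff_integrableOn_Ioo_of_le zero_le_one).symm

theorem RadialMemLp.mono {N : ℕ} {p : ℝ} {a b : ℝ → ℝ} (hp : 0 ≤ p) (ha : RadialMemLp N p a)
    (hb : Measurable b) (h : ∀ᵐ r, r ∈ Ioo (0:ℝ) 1 → |b r| ≤ |a r|) : RadialMemLp N p b := by
  refine Integrable.mono' ha (Measurable.aestronglyMeasurable (by fun_prop)) ?_
  rw [ae_restrict_iff' measurableSet_Ioo]
  filter_upwards [h] with r hr h01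
  have h0 := h01.1
  have h1 := hr h01
  rw [Real.norm_eq_abs, abs_of_nonneg (by positivity)]
  gcongr

theorem radialMemLp_of_bounded {N : ℕ} {p M : ℝ} {a : ℝ → ℝ} (hp : 0 ≤ p) (ha : Measurable a)
    (h : ∀ r ∈ Ioo (0:ℝ) 1, |a r| ≤ M) : RadialMemLp N p a := by
  have hc : RadialMemLp N p (fun _ => M) := by
    rw [radialMemLp_iff]
    exact Continuous.intervalIntegrable (by fun_prop) _ _
  exact hc.mono hp ha (Eventually.of_forall fun r hr => (h r hr).trans (le_abs_self M))

theorem RadialFluxSolution.isRadialNeumannSolution {N : ℕ} {a u U : ℝ → ℝ}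
    (h : RadialFluxSolution N a u U) : IsRadialNeumannSolution N a u := by
  refine ⟨fun r => U r / r ^ (N - 1), h.cont, h.deriv, fun r hr => ?_, by simp [h.neumann]⟩
  have := hr.1
  rw [mul_div_cancel₀ _ (by positivity), h.flux r ⟨hr.1.le, hr.2⟩]

theorem IsRadialNeumannSolution.exists_radialFluxSolution {N : ℕ} {a u : ℝ → ℝ}
    (h : IsRadialNeumannSolution N a u)
    (ha : IntervalIntegrable (fun s => s ^ (N - 1) * a s) volume 0 1) :
    ∃ U, RadialFluxSolution N a u U := by
  obtain ⟨u', hc, hd, hf, h1⟩ := h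
  refine ⟨fun r => -∫ s in (0:ℝ)..r, s ^ (N - 1) * a s * u s, hc, fun r hr => ?_, ha,
    fun r _ => rfl, ?_⟩
  · have := hr.1
    rw [← hf r hr, mul_div_cancel_left₀ _ (by positivity)]
    exact hd r hr
  · rw [← hf 1 ⟨one_pos, le_rfl⟩, h1, mul_zero]

section Lyapunov

variable {N k : ℕ} {μ : ℝ} {φ : ℝ → ℝ} {rz : ℕ → ℝ}

theorem IsRadialNeumannEigenpair.exists_radialFluxSolution
    (h : IsRadialNeumannEigenpair N k μ φ rz) : ∃ Φ, RadialFluxSolution N (fun _ => μ) φ Φ :=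
  h.2.1.exists_radialFluxSolution (Continuous.intervalIntegrable (by fun_prop) _ _)

theorem IsRadialNeumannEigenpair.ae_ne_zero (h : IsRadialNeumannEigenpair N k μ φ rz) :
    ∀ᵐ r, r ∈ Ioo (0:ℝ) 1 → φ r ≠ 0 := by
  have hfin : (rz '' (Icc 1 k)).Finite := (finite_Icc 1 k).image rz
  filter_upwards [compl_mem_ae_iff.2 (hfin.measure_zero volume)] with r hr h01 h0
  obtain ⟨i, h1, h2, rfl⟩ := (h.2.2.2.2.2.1 r h01).1 h0
  exact hr ⟨i, ⟨h1, h2⟩, rfl⟩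

theorem GammaSet.ae_le {a : ℝ → ℝ} (ha : GammaSet N μ a) : ∀ᵐ r, r ∈ Ioo (0:ℝ) 1 → μ ≤ a r :=
  (ae_restrict_iff' measurableSet_Ioo).1 ha.2.1.1

theorem GammaSet.radialMemLp_sub {a : ℝ → ℝ} (ha : GammaSet N μ a) (hμ : 0 ≤ μ) {p : ℝ}
    (hp : 0 ≤ p) (h : RadialMemLp N p a) : RadialMemLp N p (fun r => a r - μ) := by
  refine h.mono hp (ha.1.sub_const μ) ?_
  filter_upwards [ha.ae_le] with r hr h01
  have := hr h01
  rw [abs_of_nonneg (sub_nonneg.2 this), abs_of_nonneg (hμ.trans this)]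
  linarith

/-- The critical `L^{N/2}` energy is bounded below on the admissible class. -/
theorem IsRadialNeumannEigenpair.exists_critical_lower_bound (hN : 3 ≤ N)
    (h : IsRadialNeumannEigenpair N k μ φ rz) :
    ∃ ε > 0, ∀ a, GammaSet N μ a →
      ε ≤ ∫ r in (0:ℝ)..1, r ^ (N - 1) * |a r - μ| ^ ((N : ℝ) / 2) := by
  have hq : 1 ≤ (N : ℝ) / 2 := by
    have : (3:ℝ) ≤ N := by exact_mod_cast hN
    linarith
  obtain ⟨Φ, hφ⟩ := h.exists_radialFluxSolution
  obtain ⟨ε, hε, H⟩ := hφ.exists_lower_bound hN h.1 h.2.2.1 h.ae_ne_zero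
  refine ⟨ε, hε, fun a ha => ?_⟩
  have haN : RadialMemLp N ((N : ℝ) / 2) a := by
    have := ha.2.2.2
    rwa [if_pos hN] at this
  by_contra! hlt
  obtain ⟨u, hu, hnt⟩ := ha.2.2.1
  have hfi : IntervalIntegrable (fun s => s ^ (N - 1) * a s) volume 0 1 := by
    have h1 := intervalIntegrable_pow_mul_abs hq ha.1 (radialMemLp_iff.1 haN)
    have ham := ha.1
    refine h1.mono_fun (Measurable.aestronglyMeasurable (by fun_prop)) ?_
    exact Eventually.of_forall fun t => by simp
  obtain ⟨U, hU⟩ := hu.exists_radialFluxSolution hfi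
  have hb := radialMemLp_iff.1 (ha.radialMemLp_sub h.1 (zero_le_one.trans hq) haN)
  have hae := H a u U ha.1 ha.ae_le hb hU hnt hlt
  refine ha.2.1.2.ne' (measure_mono_null (t := {r | ¬(r ∈ Ioo (0:ℝ) 1 → a r = μ)}) ?_ hae)
  intro r hr
  simp only [mem_ofPred_eq, Classical.not_imp]
  exact ⟨hr.1, hr.2.ne'⟩

theorem IsRadialNeumannEigenpair.exists_mem_gammaSet_concentrated (hN : 3 ≤ N)
    (h : IsRadialNeumannEigenpair N k μ φ rz) :
    ∃ C > 0, ∀ ρ ∈ Ioo (0:ℝ) 1, μ * ρ ^ 2 < 1 → ∃ a, GammaSet N μ a ∧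
      (∀ r ∈ Ioo (0:ℝ) 1, μ ≤ a r) ∧ (∀ r ∈ Ioo (0:ℝ) 1, a r ≤ μ + C / ρ ^ 2) ∧
      (∀ r ∈ Ioc ρ 1, a r = μ) := by
  obtain ⟨Φ, hφ⟩ := h.exists_radialFluxSolution
  obtain ⟨C, hC, H⟩ := hφ.exists_concentrated hN h.1 h.2.2.1
  refine ⟨C, hC, fun ρ hρ hμρ => ?_⟩
  obtain ⟨a, u, U, ham, hu, hnt, hlow, hup, heq, hpos⟩ := H ρ hρ hμρ
  refine ⟨a, ⟨ham, ⟨?_, hpos⟩, ⟨u, hu.isRadialNeumannSolution, hnt⟩, ?_⟩, hlow, hup, heq⟩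
  · exact (ae_restrict_iff' measurableSet_Ioo).2 (Eventually.of_forall hlow)
  · rw [if_pos hN]
    refine radialMemLp_of_bounded (M := μ + C / ρ ^ 2) (by positivity) ham fun r hr => ?_
    rw [abs_of_nonneg (h.1.trans (hlow r hr))]
    exact hup r hr

theorem IsRadialNeumannEigenpair.exists_bounded_mem_gammaSet (hN : 3 ≤ N)
    (h : IsRadialNeumannEigenpair N k μ φ rz) :
    ∃ a M, GammaSet N μ a ∧ ∀ r ∈ Ioo (0:ℝ) 1, |a r| ≤ M := by
  obtain ⟨C, -, H⟩ := h.exists_mem_gammaSet_concentrated hN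
  have hμ := h.1
  have hρ : (1 / (μ + 2) : ℝ) ∈ Ioo (0:ℝ) 1 :=
    ⟨by positivity, by rw [div_lt_one (by positivity)]; linarith⟩
  obtain ⟨a, ha, hlow, hup, -⟩ := H (1 / (μ + 2)) hρ (by
    rw [div_pow, one_pow, mul_one_div, div_lt_one (by positivity)]
    nlinarith)
  refine ⟨a, μ + C / (1 / (μ + 2)) ^ 2, ha, fun r hr => ?_⟩
  rw [abs_of_nonneg (hμ.trans (hlow r hr))]
  exact hup r hr

theorem IsRadialNeumannEigenpair.gammaLyap_pos (hN : 3 ≤ N)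
    (h : IsRadialNeumannEigenpair N k μ φ rz) {p : ℝ} (hp : (N : ℝ) / 2 ≤ p) :
    0 < gammaLyap N μ p := by
  have hN' : (3:ℝ) ≤ N := by exact_mod_cast hN
  have hN2 : 0 < (N : ℝ) / 2 := by linarith
  have hp0 : 0 < p := hN2.trans_le hp
  obtain ⟨ε, hε, H⟩ := h.exists_critical_lower_bound hN
  set q := p / ((N : ℝ) / 2) with hq
  have hq1 : 1 ≤ q := by rwa [hq, one_le_div hN2]
  set E := (ε / 2) ^ (1 - q) with hE
  have hE0 : 0 < E := Real.rpow_pos_of_pos (by positivity) _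
  have hω := omegaN_pos (N := N) (by omega)
  have hpos : 0 < (omegaN N * (ε / 2 / E)) ^ (1 / p) := Real.rpow_pos_of_pos (by positivity) _
  refine hpos.trans_le (le_csInf ?_ ?_)
  · obtain ⟨a, M, ha, hM⟩ := h.exists_bounded_mem_gammaSet hN
    exact ⟨_, a, ha, radialMemLp_of_bounded hp0.le ha.1 hM, rfl⟩
  · rintro t ⟨a, ha, hap, rfl⟩
    have ham := ha.1
    have e : ∀ r, |(|a r - μ| ^ ((N : ℝ) / 2))| ^ q = |a r - μ| ^ p := fun r => by
      rw [abs_of_nonneg (Real.rpow_nonneg (abs_nonneg _) _), ← Real.rpow_mul (abs_nonneg _), hq,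
        mul_div_cancel₀ _ hN2.ne']
    have hb := radialMemLp_iff.1 (ha.radialMemLp_sub h.1 hp0.le hap)
    simp only [← e] at hb
    have h1 := integral_pow_mul_abs_le hq1 (half_pos hε)
      (by fun_prop : Measurable fun r => |a r - μ| ^ ((N : ℝ) / 2)) hb
    simp only [e] at h1
    simp only [abs_of_nonneg (Real.rpow_nonneg (abs_nonneg _) _)] at h1
    have h2 := H a ha
    simp only [radialLpNorm]
    gcongr
    rw [div_le_iff₀' hE0]
    linarith

theorem IsRadialNeumannEigenpair.gammaLyapInfty_pos (hN : 3 ≤ N)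
    (h : IsRadialNeumannEigenpair N k μ φ rz) : 0 < gammaLyapInfty N μ := by
  have hN' : (3:ℝ) ≤ N := by exact_mod_cast hN
  have hN2 : 0 < (N : ℝ) / 2 := by linarith
  obtain ⟨ε, hε, H⟩ := h.exists_critical_lower_bound hN
  have hpos : 0 < ε ^ ((N : ℝ) / 2)⁻¹ := Real.rpow_pos_of_pos hε _
  refine hpos.trans_le (le_csInf ?_ ?_)
  · obtain ⟨a, M, ha, hM⟩ := h.exists_bounded_mem_gammaSet hN
    exact ⟨_, a, ha, ⟨M, (ae_restrict_iff' measurableSet_Ioo).2 (Eventually.of_forall hM)⟩, rfl⟩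
  · rintro t ⟨a, ha, ⟨M, hM⟩, rfl⟩
    set L := radialLinftyNorm (fun r => a r - μ) with hL
    have hle : ∀ᵐ r ∂(volume.restrict (Ioo (0:ℝ) 1)), |a r - μ| ≤ L := by
      refine ae_le_essSup ?_
      refine ⟨M + |μ|, ?_⟩
      rw [eventually_map]
      filter_upwards [hM] with r hr
      exact (abs_sub _ _).trans (by linarith)
    rw [ae_restrict_iff' measurableSet_Ioo] at hle
    have hbound : ∫ r in (0:ℝ)..1, r ^ (N - 1) * |a r - μ| ^ ((N : ℝ) / 2)
        ≤ max L 0 ^ ((N : ℝ) / 2) := by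
      have h1 : ‖∫ r in (0:ℝ)..1, r ^ (N - 1) * |a r - μ| ^ ((N : ℝ) / 2)‖
          ≤ max L 0 ^ ((N : ℝ) / 2) * |1 - 0| := by
        refine intervalIntegral.norm_integral_le_of_norm_le_const_ae ?_
        rw [uIoc_of_le zero_le_one]
        filter_upwards [hle, compl_mem_ae_iff.2 (measure_singleton (1:ℝ))] with r hr hr1 h01
        have h0 := h01.1
        have h2 := hr ⟨h0, lt_of_le_of_ne h01.2 hr1⟩
        rw [Real.norm_eq_abs, abs_of_nonneg (by positivity)]
        calc r ^ (N - 1) * |a r - μ| ^ ((N : ℝ) / 2)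
            ≤ 1 * max L 0 ^ ((N : ℝ) / 2) := by
              gcongr
              · exact pow_le_one₀ h0.le h01.2
              · exact h2.trans (le_max_left _ _)
          _ = _ := one_mul _
      simpa using (le_abs_self _).trans h1
    have h3 : ε ^ ((N : ℝ) / 2)⁻¹ ≤ max L 0 :=
      (Real.rpow_inv_le_iff_of_pos hε.le (le_max_right _ _) hN2).2 ((H a ha).trans hbound)
    rcases le_max_iff.1 h3 with h4 | h4
    · exact h4
    · linarith

theorem integral_le_of_concentrated {a : ℝ → ℝ} {p C ρ : ℝ} (hN : 0 < N) (hp : 0 < p)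
    (hC : 0 ≤ C) (hρ : ρ ∈ Ioo (0:ℝ) 1) (ha : RadialMemLp N p (fun r => a r - μ))
    (hlow : ∀ r ∈ Ioo (0:ℝ) 1, μ ≤ a r) (hup : ∀ r ∈ Ioo (0:ℝ) 1, a r ≤ μ + C / ρ ^ 2)
    (heq : ∀ r ∈ Ioc ρ 1, a r = μ) :
    ∫ r in (0:ℝ)..1, r ^ (N - 1) * |a r - μ| ^ p ≤ C ^ p * ρ ^ ((N : ℝ) - 2 * p) := by
  have hρ0 := hρ.1
  rw [radialMemLp_iff] at ha
  have i1 := ha.mono_set (c := 0) (d := ρ) (by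
    rw [uIcc_of_le hρ0.le, uIcc_of_le zero_le_one]; exact Icc_subset_Icc_right hρ.2.le)
  have i2 := ha.mono_set (c := ρ) (d := 1) (by
    rw [uIcc_of_le hρ.2.le, uIcc_of_le zero_le_one]; exact Icc_subset_Icc_left hρ0.le)
  have h2 : ∫ r in ρ..1, r ^ (N - 1) * |a r - μ| ^ p = 0 := by
    rw [intervalIntegral.integral_of_le hρ.2.le]
    refine (setIntegral_congr_fun (g := fun _ => (0:ℝ)) measurableSet_Ioc fun t ht => ?_).trans
      (by simp)
    simp [heq t ht, Real.zero_rpow hp.ne']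
  have h1 : ‖∫ r in (0:ℝ)..ρ, r ^ (N - 1) * |a r - μ| ^ p‖
      ≤ ρ ^ (N - 1) * (C / ρ ^ 2) ^ p * |ρ - 0| := by
    refine intervalIntegral.norm_integral_le_of_norm_le_const fun r hr => ?_
    rw [uIoc_of_le hρ0.le] at hr
    have h0 := hr.1
    have h01 : r ∈ Ioo (0:ℝ) 1 := ⟨h0, hr.2.trans_lt hρ.2⟩
    have h3 : |a r - μ| ≤ C / ρ ^ 2 := by
      rw [abs_of_nonneg (sub_nonneg.2 (hlow r h01))]
      linarith [hup r h01]
    rw [Real.norm_eq_abs, abs_of_nonneg (by positivity)]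
    have := hr.2
    gcongr
  rw [← intervalIntegral.integral_add_adjacent_intervals i1 i2, h2, add_zero]
  refine (le_abs_self _).trans (h1.trans_eq ?_)
  have e : ρ ^ (N - 1) * ρ = ρ ^ (N : ℝ) := by
    rw [← pow_succ, Nat.sub_add_cancel hN, Real.rpow_natCast]
  rw [sub_zero, abs_of_pos hρ0, Real.div_rpow hC (by positivity), Real.rpow_sub hρ0, ← e,
    ← Real.rpow_natCast ρ 2, ← Real.rpow_mul hρ0.le]
  push_cast
  ring

theorem IsRadialNeumannEigenpair.not_gammaLyap_pos (hN : 3 ≤ N)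
    (h : IsRadialNeumannEigenpair N k μ φ rz) {p : ℝ} (hp1 : 1 ≤ p) (hp : p < (N : ℝ) / 2) :
    ¬ 0 < gammaLyap N μ p := by
  intro hpos
  have hp0 : 0 < p := one_pos.trans_le hp1
  have hω := omegaN_pos (N := N) (by omega)
  obtain ⟨C, hC, H⟩ := h.exists_mem_gammaSet_concentrated hN
  have hexp : 0 < (N : ℝ) - 2 * p := by linarith
  have hlim : Tendsto (fun ρ : ℝ => (omegaN N * (C ^ p * ρ ^ ((N : ℝ) - 2 * p))) ^ (1 / p))
      (𝓝[>] 0) (𝓝 0) := by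
    have hc : Continuous fun ρ : ℝ => (omegaN N * (C ^ p * ρ ^ ((N : ℝ) - 2 * p))) ^ (1 / p) :=
      ((continuous_const.mul (continuous_const.mul
        (Real.continuous_rpow_const hexp.le)))).rpow_const fun _ => Or.inr (by positivity)
    refine (hc.tendsto' 0 0 ?_).mono_left nhdsWithin_le_nhds
    rw [Real.zero_rpow hexp.ne', mul_zero, mul_zero, Real.zero_rpow (by positivity)]
  have hμρ : ∀ᶠ ρ : ℝ in 𝓝[>] 0, μ * ρ ^ 2 < 1 :=
    (((by fun_prop : Continuous fun ρ : ℝ => μ * ρ ^ 2).tendsto' 0 0 (by simp)).mono_left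
      nhdsWithin_le_nhds).eventually_lt_const one_pos
  obtain ⟨ρ, ⟨hlt, hμρ⟩, hρ⟩ := (((hlim.eventually_lt_const hpos).and hμρ).and
    (Ioo_mem_nhdsGT one_pos)).exists
  obtain ⟨a, ha, hlow, hup, heq⟩ := H ρ hρ hμρ
  have hmem : RadialMemLp N p a :=
    radialMemLp_of_bounded (M := μ + C / ρ ^ 2) hp0.le ha.1 fun r hr => by
      rw [abs_of_nonneg (h.1.trans (hlow r hr))]
      exact hup r hr
  have hle : gammaLyap N μ p ≤ radialLpNorm N p (fun r => a r - μ) := by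
    refine csInf_le ⟨0, ?_⟩ ⟨a, ha, hmem, rfl⟩
    rintro t ⟨b, -, -, rfl⟩
    exact radialLpNorm_nonneg _ _ _
  have hfi := integral_le_of_concentrated (by omega) hp0 hC.le hρ
    (ha.radialMemLp_sub h.1 hp0.le hmem) hlow hup heq
  have hint0 : 0 ≤ ∫ r in (0:ℝ)..1, r ^ (N - 1) * |a r - μ| ^ p :=
    intervalIntegral.integral_nonneg zero_le_one fun t ht => by
      have := ht.1
      positivity
  refine (hle.trans ?_).not_gt hlt
  unfold radialLpNorm
  gcongr

end Lyapunov

/-- For `N ≥ 3` and any radial Neumann eigenpair of index `k`, the Lyapunov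
constant `γ_{p,k}` is strictly positive iff `N/2 ≤ p ≤ ∞` (in particular `γ_{p,k} = 0`
whenever `1 ≤ p < N/2`). -/
theorem stmt1 (N k : ℕ) (hN : 3 ≤ N) (μk : ℝ) (φk : ℝ → ℝ) (rz : ℕ → ℝ)
    (hek : IsRadialNeumannEigenpair N k μk φk rz) :
    (∀ p : ℝ, 1 ≤ p → (0 < gammaLyap N μk p ↔ (N : ℝ) / 2 ≤ p)) ∧
    0 < gammaLyapInfty N μk := by
  refine ⟨fun p hp => ⟨fun h => ?_, fun h => hek.gammaLyap_pos hN h⟩, hek.gammaLyapInfty_pos hN⟩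
  by_contra! hlt
  exact hek.not_gammaLyap_pos hN hp hlt h
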